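/- arXiv:2004.06232 — 4 statements merged into one kernel-verified Lean document; each statement's English description precedes it below -/
import Mathlib

section
/- The triple integral ∫₁^∞ ∫₀¹ ∫₀¹ 1/(x(x+y)(x+y+z)) dz dy dx equals (5/24)·ζ(3). -/
open Real Set Filter Topology MeasureTheory

noncomputable def Fq (x : ℝ) : ℝ := ∫ s in (0:ℝ)..x, (log (1 - s))^2 / s

lemma fq_cont {x : ℝ} (hx : x < 1) : ContinuousAt (fun s : ℝ => (log (1 - s))^2 / s) x := by
  have hl : ContinuousAt (fun s : ℝ => log (1 - s)) x :=
    (continuousAt_const.sub continuousAt_id).log (by simp; linarith)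
  by_cases h0 : x = 0
  · subst h0
    have hd : HasDerivAt (fun s : ℝ => log (1 - s)) (-1) 0 := by
      have := ((hasDerivAt_id (0:ℝ)).const_sub 1).log (by simp)
      simpa using this
    have hs := hd.tendsto_slope_zero
    rw [continuousAt_iff_punctured_nhds]
    have h2 : Tendsto (fun s : ℝ => log (1 - s)) (𝓝[≠] 0) (𝓝 0) := by
      have := hl.tendsto.mono_left (nhdsWithin_le_nhds (s := {0}ᶜ))
      simpa using this
    have h3 := hs.mul h2
    simp only [smul_eq_mul, zero_add, sub_zero, log_one, mul_zero] at h3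
    simp only [sub_zero, log_one, div_zero]
    refine h3.congr (fun s => ?_)
    ring
  · exact (hl.pow 2).div continuousAt_id h0

lemma Fq_hasDeriv {x : ℝ} (hx : x < 1) : HasDerivAt Fq ((log (1 - x))^2 / x) x := by
  have hc : ContinuousOn (fun s : ℝ => (log (1 - s))^2 / s) (Iio 1) :=
    fun s hs => (fq_cont hs).continuousWithinAt
  apply intervalIntegral.integral_hasDerivAt_right
  · apply ContinuousOn.intervalIntegrable
    apply hc.mono
    intro s hs
    rcases hs with ⟨_, h2⟩
    exact lt_of_le_of_lt h2 (by simpa using hx)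
  · exact hc.stronglyMeasurableAtFilter isOpen_Iio x hx
  · exact fq_cont hx

lemma Fq_zero : Fq 0 = 0 := by simp [Fq]

lemma Fq_comp {g : ℝ → ℝ} {g' x : ℝ} (hg : HasDerivAt g g' x) (h : g x < 1) :
    HasDerivAt (fun t => Fq (g t)) ((log (1 - g x))^2 / g x * g') x :=
  (Fq_hasDeriv h).comp x hg

lemma const_aux {f : ℝ → ℝ} {a b : ℝ} (hab : a ≤ b) (h : ∀ x ∈ Icc a b, HasDerivAt f 0 x) :
    f b = f a :=
  constant_of_has_deriv_right_zero (fun x hx => (h x hx).continuousAt.continuousWithinAt)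
    (fun x hx => (h x ⟨hx.1, hx.2.le⟩).hasDerivWithinAt) b ⟨hab, le_rfl⟩

lemma Fq_neg {b : ℝ} (hb : 0 ≤ b) : Fq (-b) = Fq (b / (1 + b)) + (log (1 + b))^3 / 3 := by
  have key := const_aux (f := fun x => Fq (-x) - Fq (x / (1 + x)) - (log (1 + x))^3 / 3) hb ?_
  · simp [Fq_zero] at key
    linarith
  intro x hx
  have h1 : (0:ℝ) < 1 + x := by linarith [hx.1]
  have e1 := Fq_comp (hasDerivAt_neg x) (by linarith [hx.1])
  have e2 := Fq_comp ((hasDerivAt_id x).div ((hasDerivAt_id x).const_add 1) h1.ne')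
    (by simp only [Pi.div_apply, id]; rw [div_lt_one h1]; linarith)
  have e3 := ((((hasDerivAt_id x).const_add 1).log h1.ne').pow 3).div_const 3
  refine ((e1.sub e2).sub e3).congr_deriv ?_
  have l1 : 1 - x / (1 + x) = (1 + x)⁻¹ := by field_simp; ring
  simp only [Pi.div_apply, id, l1, log_inv, sub_neg_eq_add]
  by_cases h0 : x = 0
  · simp [h0]
  · field_simp
    ring

/-- the identity coming from `(a+b)^2+(a-b)^2 = 2a^2+2b^2`. -/
lemma Fq_A {b : ℝ} (hb : 0 ≤ b) (hb1 : b < 1) :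
    2 * Fq b + 2 * Fq (-b) = Fq (b^2) / 2 + Fq (2 * b / (1 + b)) + Fq ((1 - b) / 2)
      + Fq ((1 + b) / 2) + 2 / 3 * (log 2 - log (1 + b))^3
      - (log (1 - b) - log (1 + b)) * (log 2 - log (1 + b))^2 - 2 * Fq (-1) := by
  have key := const_aux (f := fun x => 2 * Fq x + 2 * Fq (-x) - Fq (x^2) / 2 - Fq (2 * x / (1 + x))
      - Fq ((1 - x) / 2)
      - Fq ((1 + x) / 2) - 2 / 3 * (log 2 - log (1 + x))^3
      + (log (1 - x) - log (1 + x)) * (log 2 - log (1 + x))^2) hb ?_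
  · have hn := Fq_neg (b := 1) (by norm_num)
    norm_num at hn
    norm_num [Fq_zero] at key
    linarith
  intro x hx
  have h1 : (0:ℝ) < 1 + x := by linarith [hx.1]
  have h2 : (0:ℝ) < 1 - x := by linarith [hx.2]
  have hx0 := hx.1
  have e1 := (Fq_hasDeriv (x := x) (by linarith)).const_mul 2
  have e2 := (Fq_comp (hasDerivAt_neg x) (by linarith)).const_mul 2
  have e3 := (Fq_comp ((hasDerivAt_id x).pow 2) (by simp only [Pi.pow_apply, id]; nlinarith)).div_const 2
  have e4 := Fq_comp (((hasDerivAt_id x).const_mul 2).div ((hasDerivAt_id x).const_add 1) h1.ne')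
    (by simp only [Pi.div_apply, id]; rw [div_lt_one h1]; linarith)
  have e5 := Fq_comp (((hasDerivAt_id x).const_sub 1).div_const 2) (by simp only [id]; linarith)
  have e6 := Fq_comp (((hasDerivAt_id x).const_add 1).div_const 2) (by simp only [id]; linarith)
  have lb := ((hasDerivAt_id x).const_add 1).log h1.ne'
  have la := ((hasDerivAt_id x).const_sub 1).log h2.ne'
  have e7 := ((lb.const_sub (log 2)).pow 3).const_mul (2/3)
  have e8 := (la.sub lb).mul ((lb.const_sub (log 2)).pow 2)
  refine (((((((e1.add e2).sub e3).sub e4).sub e5).sub e6).sub e7).add e8).congr_deriv ?_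
  have l1 : log (1 - 2 * x / (1 + x)) = log (1 - x) - log (1 + x) := by
    rw [← log_div h2.ne' h1.ne']; congr 1; field_simp; ring
  have l2 : log (1 - x ^ 2) = log (1 - x) + log (1 + x) := by
    rw [← log_mul h2.ne' h1.ne']; congr 1; ring
  have l3 : log (1 - (1 - x) / 2) = log (1 + x) - log 2 := by
    rw [← log_div h1.ne' two_ne_zero]; congr 1; ring
  have l4 : log (1 - (1 + x) / 2) = log (1 - x) - log 2 := by
    rw [← log_div h2.ne' two_ne_zero]; congr 1; ring
  simp only [Pi.div_apply, Pi.pow_apply, Pi.sub_apply, id, l1, l2, l3, l4, sub_neg_eq_add]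
  by_cases h0 : x = 0
  · simp [h0]; ring
  · generalize log (1 + x) = b
    generalize log (1 - x) = a
    generalize log 2 = c
    field_simp
    ring

noncomputable def Qq (y : ℝ) : ℝ := -(log y)^2 * log (1 + y) + Fq (-y) + Fq (-(1 / y))
  + (log y)^3 / 3 - 2 * Fq (-1)

lemma Qq_hasDeriv {y : ℝ} (hy : 0 < y) : HasDerivAt Qq (-(log y)^2 / (1 + y)) y := by
  have h1 : (0:ℝ) < 1 + y := by linarith
  have lb := ((hasDerivAt_id y).const_add 1).log h1.ne'
  have ly := hasDerivAt_log hy.ne'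
  have hp : 0 < 1 / y := by positivity
  have e1 := (ly.pow 2).neg.mul lb
  have e2 := Fq_comp (hasDerivAt_neg y) (by linarith)
  have e3 := Fq_comp (((hasDerivAt_const y (1:ℝ)).div (hasDerivAt_id y) hy.ne').neg)
    (by simp only [Pi.neg_apply, Pi.div_apply, id]; linarith)
  have e4 := (ly.pow 3).div_const 3
  refine ((((e1.add e2).add e3).add e4).sub_const (2 * Fq (-1))).congr_deriv ?_
  have l1 : log (1 + 1 / y) = log (1 + y) - log y := by
    rw [← log_div h1.ne' hy.ne']; congr 1; field_simp; ring
  simp only [Pi.neg_apply, Pi.div_apply, Pi.pow_apply, id, sub_neg_eq_add, l1]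
  generalize log (1 + y) = b
  generalize log y = a
  field_simp
  ring

lemma Fq_B {b : ℝ} (hb : 0 < b) (hb1 : b ≤ 1) : Fq (1 - b^2) = 4 * Fq (1 - b) - 4 * Qq b := by
  have key := const_aux (f := fun x => Fq (1 - x^2) - 4 * Fq (1 - x) + 4 * Qq x) hb1 ?_
  · norm_num [Fq_zero, Qq] at key
    simp only [Qq]
    norm_num
    linarith
  intro x hx
  have hx0 : 0 < x := lt_of_lt_of_le hb hx.1
  have hx1 := hx.2
  have e1 := Fq_comp (((hasDerivAt_id x).pow 2).const_sub 1)
    (by simp only [Pi.pow_apply, id]; nlinarith)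
  have e2 := (Fq_comp ((hasDerivAt_id x).const_sub 1)
    (by simp only [id]; linarith)).const_mul 4
  have e3 := (Qq_hasDeriv hx0).const_mul 4
  refine ((e1.sub e2).add e3).congr_deriv ?_
  simp only [Pi.pow_apply, id, sub_sub_cancel, log_pow]
  by_cases h0 : x = 1
  · simp [h0]
  · have h2 : 1 - x ≠ 0 := fun h => h0 (by linarith)
    have h3 : 1 - x^2 ≠ 0 := by
      have : 1 - x^2 = (1-x)*(1+x) := by ring
      rw [this]; exact mul_ne_zero h2 (by positivity)
    push_cast
    generalize log x = a
    field_simp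
    ring

lemma mul_log_sq {u : ℝ} (hu : 0 ≤ u) : u * (log u)^2 = 4 * (√u * log √u)^2 := by
  rw [log_sqrt hu, mul_pow, sq_sqrt hu]; ring

lemma cont_mul_log_sq : ContinuousOn (fun u : ℝ => u * (log u)^2) (Ici 0) := by
  have h : Continuous (fun u : ℝ => 4 * (√u * log √u)^2) := by
    have := Real.continuous_mul_log.comp Real.continuous_sqrt
    exact continuous_const.mul (this.pow 2)
  exact h.continuousOn.congr (fun u hu => mul_log_sq hu)

noncomputable def Pn (n : ℕ) (u : ℝ) : ℝ :=
  u^n * ((u * (log u)^2) / (n+1) - 2 * (u * log u) / (n+1)^2 + 2 * u / (n+1)^3)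

lemma Pn_cont (n : ℕ) : ContinuousOn (Pn n) (Icc 0 1) := by
  have h := cont_mul_log_sq.mono (fun (_ : ℝ) (hu : _ ∈ Icc (0:ℝ) 1) => hu.1)
  have h2 := Real.continuous_mul_log.continuousOn (s := Icc (0:ℝ) 1)
  unfold Pn
  fun_prop

lemma Pn_deriv (n : ℕ) {u : ℝ} (hu : 0 < u) : HasDerivAt (Pn n) (u^n * (log u)^2) u := by
  have ly := hasDerivAt_log hu.ne'
  have i := hasDerivAt_id u
  have hn : (n:ℝ) + 1 ≠ 0 := by positivity
  have e := (hasDerivAt_pow n u).mul ((((i.mul (ly.pow 2)).div_const ((n:ℝ)+1)).sub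
    (((i.mul ly).const_mul 2).div_const (((n:ℝ)+1)^2))).add
    ((i.const_mul 2).div_const (((n:ℝ)+1)^3)))
  refine e.congr_deriv ?_
  simp only [Pi.mul_apply, Pi.pow_apply, Pi.add_apply, Pi.sub_apply, id]
  have hp : (n:ℝ) * u^(n-1) * u = n * u^n := by
    cases n with
    | zero => simp
    | succ k => simp [pow_succ]; ring
  have hp' : (n:ℝ) * u^(n-1) = n * u^n / u := by field_simp; linarith
  rw [hp']
  generalize log u = a
  field_simp
  ring

lemma Pn_int (n : ℕ) : IntegrableOn (fun u : ℝ => u^n * (log u)^2) (Ioc 0 1) :=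
  intervalIntegral.integrableOn_deriv_of_nonneg (Pn_cont n) (fun u hu => Pn_deriv n hu.1)
    (fun u hu => by have := hu.1; positivity)

lemma Pn_val (n : ℕ) : ∫ u in Ioc (0:ℝ) 1, u^n * (log u)^2 = 2 / ((n:ℝ)+1)^3 := by
  rw [← intervalIntegral.integral_of_le zero_le_one,
    intervalIntegral.integral_eq_sub_of_hasDerivAt_of_le zero_le_one (Pn_cont n)
      (fun u hu => Pn_deriv n hu.1)]
  · simp [Pn]
  · rw [intervalIntegrable_iff_integrableOn_Ioc_of_le zero_le_one]
    exact Pn_int n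

lemma summable_z : Summable (fun n : ℕ => 1 / ((n:ℝ)+1)^3) := by
  have := (summable_nat_add_iff 1).2 (Real.summable_one_div_nat_pow.2 (by norm_num : 1 < 3))
  simpa using this

lemma Fq_one : Fq 1 = 2 * ∑' n : ℕ, 1 / ((n:ℝ)+1)^3 := by
  have h1 : Fq 1 = ∫ u in (0:ℝ)..1, (log u)^2 / (1 - u) := by
    have := intervalIntegral.integral_comp_sub_left (fun u : ℝ => (log u)^2 / (1 - u)) (1:ℝ)
      (a := 0) (b := 1)
    simp only [sub_sub_cancel, sub_self, sub_zero] at this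
    exact this
  have h2 := MeasureTheory.hasSum_integral_of_summable_integral_norm
    (μ := volume.restrict (Ioc (0:ℝ) 1)) (F := fun (n : ℕ) (u : ℝ) => u^n * (log u)^2) Pn_int ?_
  · rw [h1, intervalIntegral.integral_of_le zero_le_one, ← tsum_mul_left]
    have h3 : ∫ u in Ioc (0:ℝ) 1, ∑' n : ℕ, u^n * (log u)^2
        = ∫ u in Ioc (0:ℝ) 1, (log u)^2 / (1 - u) := by
      apply setIntegral_congr_fun measurableSet_Ioc
      intro u hu
      simp only
      rcases eq_or_lt_of_le hu.2 with h | h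
      · simp [h]
      · rw [tsum_mul_right, tsum_geometric_of_lt_one hu.1.le h]; ring
    rw [← h3, ← h2.tsum_eq]
    congr 1; ext n
    simp only [Pn_val]; ring
  · have : ∀ n : ℕ, ∫ u in Ioc (0:ℝ) 1, ‖u^n * (log u)^2‖ = 2 * (1 / ((n:ℝ)+1)^3) := by
      intro n
      rw [mul_one_div, ← Pn_val n]
      apply setIntegral_congr_fun measurableSet_Ioc
      intro u hu
      have := hu.1
      simp only [norm_eq_abs]
      exact abs_of_nonneg (by positivity)
    simp only [this]
    exact summable_z.mul_left 2

lemma fq_int : IntegrableOn (fun s : ℝ => (log (1 - s))^2 / s) (Icc 0 1) := by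
  rw [← Icc_union_Icc_eq_Icc (by norm_num : (0:ℝ) ≤ 1/2) (by norm_num : (1/2:ℝ) ≤ 1)]
  apply IntegrableOn.union
  · apply ContinuousOn.integrableOn_Icc
    intro s hs
    exact (fq_cont (by linarith [hs.2])).continuousWithinAt
  · have h0 : IntervalIntegrable (fun u : ℝ => (log u)^2) volume 0 1 := by
      rw [intervalIntegrable_iff_integrableOn_Ioc_of_le zero_le_one]
      simpa using Pn_int 0
    have h1 := (h0.comp_sub_left 1).symm
    simp only [sub_self, sub_zero] at h1
    rw [intervalIntegrable_iff_integrableOn_Icc_of_le zero_le_one] at h1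
    have h2 := (h1.mono_set (Icc_subset_Icc_left (by norm_num : (0:ℝ) ≤ 1/2))).const_mul 2
    refine Integrable.mono' h2 ?_ ?_
    · apply Measurable.aestronglyMeasurable
      fun_prop
    · refine (ae_restrict_mem measurableSet_Icc).mono (fun s hs => ?_)
      have hs0 : 0 < s := by linarith [hs.1]
      rw [norm_eq_abs, abs_of_nonneg (by positivity), div_le_iff₀ hs0]
      nlinarith [sq_nonneg (log (1 - s)), hs.1]

lemma Fq_tendsto : Tendsto Fq (𝓝[<] 1) (𝓝 (Fq 1)) := by
  have h := intervalIntegral.continuousOn_primitive_interval (a := 0) (b := 1) (μ := volume)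
    (f := fun s : ℝ => (log (1 - s))^2 / s) (by rw [uIcc_of_le zero_le_one]; exact fq_int)
  rw [uIcc_of_le zero_le_one] at h
  have h1 := (h 1 (by simp)).mono Ioo_subset_Icc_self
  have : 𝓝[Ioo 0 1] (1:ℝ) = 𝓝[<] 1 := nhdsWithin_Ioo_eq_nhdsLT zero_lt_one
  rw [ContinuousWithinAt, this] at h1
  exact h1

lemma Fq_neg_one : Fq (-1) = Fq 1 / 8 := by
  have comp : ∀ g : ℝ → ℝ, ContinuousAt g 1 → g 1 = 1 → (∀ x ∈ Ioo (0:ℝ) 1, g x < 1) →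
      Tendsto (fun x => Fq (g x)) (𝓝[<] 1) (𝓝 (Fq 1)) := by
    intro g hg h1 hlt
    apply Fq_tendsto.comp
    apply tendsto_nhdsWithin_of_tendsto_nhds_of_eventually_within
    · have := hg.tendsto.mono_left (nhdsWithin_le_nhds (s := Iio 1))
      rwa [h1] at this
    · filter_upwards [Ioo_mem_nhdsLT (zero_lt_one (α := ℝ))] with x hx
      exact hlt x hx
  have lc : ∀ g : ℝ → ℝ, ContinuousAt g 1 → Tendsto g (𝓝[<] 1) (𝓝 (g 1)) :=
    fun g hg => hg.tendsto.mono_left nhdsWithin_le_nhds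
  have t1 := comp (fun x => x) continuousAt_id rfl (fun x hx => hx.2)
  have t2 := lc (fun x => Fq (-x)) ((Fq_comp (hasDerivAt_neg 1) (by norm_num)).continuousAt)
  have t3 := comp (fun x => x^2) (by fun_prop) (by simp) (fun x hx => by nlinarith [hx.1, hx.2])
  have t4 := comp (fun x => 2 * x / (1 + x)) (by fun_prop (disch := norm_num)) (by norm_num)
    (fun x hx => by rw [div_lt_one] <;> linarith [hx.1, hx.2])
  have t5 := lc (fun x => Fq ((1 - x) / 2)) ((Fq_comp (((hasDerivAt_id (1:ℝ)).const_sub 1).div_const 2)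
    (by norm_num)).continuousAt)
  have t6 := comp (fun x => (1 + x) / 2) (by fun_prop) (by norm_num)
    (fun x hx => by linarith [hx.1, hx.2])
  have t7 := lc (fun x => 2 / 3 * (log 2 - log (1 + x))^3)
    (by fun_prop (disch := norm_num))
  have t8 := lc (fun x => log (1 + x) * (log 2 - log (1 + x))^2)
    (by fun_prop (disch := norm_num))
  have t9 : Tendsto (fun x => log (1 - x) * (log 2 - log (1 + x))^2) (𝓝[<] 1) (𝓝 0) := by
    have hm := lc (fun x => ‖(1 - x) * log (1 - x)‖) (by
      have := Real.continuous_mul_log.comp (continuous_const.sub continuous_id : Continuous fun x : ℝ => 1 - x)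
      exact this.norm.continuousAt)
    simp only [sub_self, zero_mul, norm_zero] at hm
    refine squeeze_zero_norm' ?_ hm
    filter_upwards [Ioo_mem_nhdsLT (zero_lt_one (α := ℝ))] with x hx
    have hx0 := hx.1
    have hx1 := hx.2
    rw [norm_mul, norm_mul, mul_comm ‖1 - x‖]
    apply mul_le_mul_of_nonneg_left _ (norm_nonneg _)
    rw [norm_eq_abs, norm_eq_abs, abs_of_nonneg (sq_nonneg _), abs_of_nonneg (by linarith)]
    have a1 : log (1 + x) ≤ log 2 := log_le_log (by linarith) (by linarith)
    have a2 : log 2 - log (1 + x) ≤ 1 - x := by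
      rw [← log_div two_ne_zero (by linarith)]
      refine (log_le_sub_one_of_pos (by positivity)).trans ?_
      rw [sub_le_iff_le_add, div_le_iff₀ (by linarith)]
      nlinarith
    nlinarith
  have L := ((t1.const_mul 2).add (t2.const_mul 2))
  have R := (((((((t3.div_const 2).add t4).add t5).add t6).add t7).sub (t9.sub t8)).sub_const
    (2 * Fq (-1)))
  have E := tendsto_nhds_unique (L.congr' ?_) R
  · norm_num [Fq_zero] at E
    linarith
  · filter_upwards [Ioo_mem_nhdsLT (zero_lt_one (α := ℝ))] with x hx
    rw [Fq_A hx.1.le hx.2]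
    ring

noncomputable def Mq (s : ℝ) : ℝ := (Fq (s^2) / 2 - Fq s - Fq (-s)) / 2

lemma Mq_deriv {s : ℝ} (h0 : 0 < s) (h1 : s < 1) :
    HasDerivAt Mq (log (1 - s) * log (1 + s) / s) s := by
  have hb : (0:ℝ) < 1 + s := by linarith
  have ha : (0:ℝ) < 1 - s := by linarith
  have e1 := (Fq_comp ((hasDerivAt_id s).pow 2) (by simp only [Pi.pow_apply, id]; nlinarith)).div_const 2
  have e2 := Fq_hasDeriv h1
  have e3 := Fq_comp (hasDerivAt_neg s) (by linarith)
  refine (((e1.sub e2).sub e3).div_const 2).congr_deriv ?_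
  have l2 : log (1 - s ^ 2) = log (1 - s) + log (1 + s) := by
    rw [← log_mul ha.ne' hb.ne']; congr 1; ring
  simp only [Pi.pow_apply, id, l2, sub_neg_eq_add]
  field_simp
  ring

noncomputable def Nq (s : ℝ) : ℝ := (Qq s + (log s)^2 * log (1 + s)) / 2

lemma Nq_deriv {s : ℝ} (h0 : 0 < s) : HasDerivAt Nq (log s * log (1 + s) / s) s := by
  have hb : (0:ℝ) < 1 + s := by linarith
  have lb := ((hasDerivAt_id s).const_add 1).log hb.ne'
  have ly := hasDerivAt_log h0.ne'
  refine (((Qq_hasDeriv h0).add ((ly.pow 2).mul lb)).div_const 2).congr_deriv ?_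
  simp only [Pi.pow_apply, id]
  field_simp
  ring

lemma Qq_eq {y : ℝ} (hy : 0 < y) : Qq y = Fq (-y) + Fq (1 / (1 + y)) + (log (1 + y))^3 / 3
    - (log (1 + y))^2 * log y - 2 * Fq (-1) := by
  have h1 : (0:ℝ) < 1 + y := by linarith
  have hp : 0 < 1 / y := by positivity
  have l1 : log (1 + 1 / y) = log (1 + y) - log y := by
    rw [← log_div h1.ne' hy.ne']; congr 1; field_simp; ring
  have l2 : 1 / y / (1 + 1 / y) = 1 / (1 + y) := by field_simp; ring
  rw [Qq, Fq_neg hp.le, l1, l2]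
  ring

lemma Nq_tendsto : Tendsto Nq (𝓝[>] 0) (𝓝 (Fq 1 / 2 - Fq (-1))) := by
  have lc : ∀ g : ℝ → ℝ, ContinuousAt g 0 → Tendsto g (𝓝[>] 0) (𝓝 (g 0)) :=
    fun g hg => hg.tendsto.mono_left nhdsWithin_le_nhds
  have t1 := lc (fun x => Fq (-x)) ((Fq_comp (hasDerivAt_neg 0) (by norm_num)).continuousAt)
  have t2 : Tendsto (fun y : ℝ => Fq (1 / (1 + y))) (𝓝[>] 0) (𝓝 (Fq 1)) := by
    apply Fq_tendsto.comp
    apply tendsto_nhdsWithin_of_tendsto_nhds_of_eventually_within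
    · have := lc (fun y => 1 / (1 + y)) (by fun_prop (disch := norm_num))
      simpa using this
    · filter_upwards [self_mem_nhdsWithin] with y hy
      have : (0:ℝ) < y := hy
      rw [mem_Iio, div_lt_one] <;> linarith
  have t3 := lc (fun y => (log (1 + y))^3 / 3) (by fun_prop (disch := norm_num))
  have hle : ∀ y : ℝ, 0 < y → |log (1 + y)| ≤ y := by
    intro y hy
    rw [abs_of_nonneg (log_nonneg (by linarith))]
    linarith [log_le_sub_one_of_pos (by linarith : 0 < 1 + y)]
  have t4 : Tendsto (fun y : ℝ => log (1 + y) * log y) (𝓝[>] 0) (𝓝 0) := by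
    have hm := lc (fun x => ‖x * log x‖) Real.continuous_mul_log.norm.continuousAt
    simp only [zero_mul, norm_zero] at hm
    refine squeeze_zero_norm' ?_ hm
    filter_upwards [self_mem_nhdsWithin] with y hy
    have hy : (0:ℝ) < y := hy
    rw [norm_mul, norm_mul]
    apply mul_le_mul_of_nonneg_right _ (norm_nonneg _)
    rw [norm_eq_abs, norm_eq_abs, abs_of_pos hy]
    exact hle y hy
  have t4' := lc (fun y => log (1 + y)) (by fun_prop (disch := norm_num))
  have t5 : Tendsto (fun y : ℝ => (log y)^2 * log (1 + y)) (𝓝[>] 0) (𝓝 0) := by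
    have hm := (cont_mul_log_sq 0 (by simp)).mono Ioi_subset_Ici_self
    rw [ContinuousWithinAt] at hm
    simp only [zero_mul] at hm
    refine squeeze_zero_norm' ?_ hm
    filter_upwards [self_mem_nhdsWithin] with y hy
    have hy : (0:ℝ) < y := hy
    rw [norm_mul, norm_eq_abs, norm_eq_abs, abs_of_nonneg (sq_nonneg _), mul_comm]
    exact mul_le_mul_of_nonneg_right (hle y hy) (sq_nonneg _)
  have T := ((((((t1.add t2).add t3).sub (t4.mul t4')).sub_const (2 * Fq (-1)))).add t5).div_const 2
  have e : (Fq (-0) + Fq 1 + log (1 + 0) ^ 3 / 3 - 0 * log (1 + 0) - 2 * Fq (-1) + 0) / 2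
      = Fq 1 / 2 - Fq (-1) := by
    simp [Fq_zero]; ring
  rw [e] at T
  refine T.congr' ?_
  filter_upwards [self_mem_nhdsWithin] with y hy
  rw [Nq, Qq_eq hy]
  ring

noncomputable def hq (u : ℝ) : ℝ := (log (u + 1) - log u) / u

noncomputable def Hq (u : ℝ) : ℝ := ∫ t in (1:ℝ)..u, hq t

lemma hq_cont : ContinuousOn hq (Ioi 0) := by
  intro u hu
  have hu : (0:ℝ) < u := hu
  have h1 : u + 1 ≠ 0 := by positivity
  have h2 := hu.ne'
  unfold hq
  apply ContinuousAt.continuousWithinAt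
  fun_prop (disch := assumption)

lemma hq_int {a b : ℝ} (ha : 0 < a) (hb : 0 < b) : IntervalIntegrable hq volume a b :=
  ContinuousOn.intervalIntegrable (hq_cont.mono (fun _ hs => lt_of_lt_of_le (lt_min ha hb) hs.1))

lemma Hq_deriv {u : ℝ} (hu : 0 < u) : HasDerivAt Hq (hq u) u :=
  intervalIntegral.integral_hasDerivAt_right (hq_int one_pos hu)
    (hq_cont.stronglyMeasurableAtFilter isOpen_Ioi u hu) (hq_cont.continuousAt (Ioi_mem_nhds hu))

lemma hq_nonneg {u : ℝ} (hu : 0 < u) : 0 ≤ hq u :=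
  div_nonneg (sub_nonneg.2 (log_le_log hu (by linarith))) hu.le

lemma hq_le {x u : ℝ} (hx : 1 ≤ x) (hu : x ≤ u) : hq u ≤ 1 / x := by
  have h0 : 0 < u := by linarith
  rw [hq, ← log_div (by positivity) h0.ne', div_le_div_iff₀ h0 (by linarith)]
  have : log ((u + 1) / u) ≤ 1 := by
    refine (log_le_sub_one_of_pos (by positivity)).trans ?_
    rw [sub_le_iff_le_add, div_le_iff₀ h0]; linarith
  nlinarith

lemma Hq_sub {x : ℝ} (hx : 0 < x) : Hq (x + 1) - Hq x = ∫ t in x..(x+1), hq t := by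
  rw [Hq, Hq, intervalIntegral.integral_interval_sub_left (hq_int one_pos (by linarith))
    (hq_int one_pos hx)]

noncomputable def Phi (x : ℝ) : ℝ := log x * (Hq (x + 1) - Hq x) - Nq (1 / (x + 1))
  + Mq (1 / (x + 1)) + Nq (1 / x)

lemma Phi_deriv {x : ℝ} (hx : 1 ≤ x) : HasDerivAt Phi ((Hq (x + 1) - Hq x) / x) x := by
  have h0 : 0 < x := by linarith
  have h1 : 0 < x + 1 := by linarith
  have h2 : 0 < x + 2 := by linarith
  have i := hasDerivAt_id x
  have d1 : HasDerivAt (fun t : ℝ => Hq (t + 1)) (hq (x + 1)) x := (Hq_deriv h1).comp_add_const x 1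
  have s1 : HasDerivAt (fun t : ℝ => 1 / (t + 1)) (-1 / (x+1)^2) x := by
    refine ((hasDerivAt_const x (1:ℝ)).div (i.add_const 1) h1.ne').congr_deriv ?_
    simp
  have s0 : HasDerivAt (fun t : ℝ => 1 / t) (-1 / x^2) x := by
    refine ((hasDerivAt_const x (1:ℝ)).div i h0.ne').congr_deriv ?_
    simp
  have p1 : 0 < 1 / (x + 1) := by positivity
  have p0 : 0 < 1 / x := by positivity
  have q1 : 1 / (x + 1) < 1 := by rw [div_lt_one h1]; linarith
  have n1 := HasDerivAt.comp (h₂ := Nq) x (Nq_deriv p1) s1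
  have m1 := HasDerivAt.comp (h₂ := Mq) x (Mq_deriv p1 q1) s1
  have n0 := HasDerivAt.comp (h₂ := Nq) x (Nq_deriv p0) s0
  refine (((((hasDerivAt_log h0.ne').mul (d1.sub (Hq_deriv h0))).sub n1).add m1).add n0).congr_deriv ?_
  have l1 : log (1 / (x + 1)) = - log (x + 1) := by rw [one_div, log_inv]
  have l0 : log (1 / x) = - log x := by rw [one_div, log_inv]
  have l2 : log (1 + 1 / (x + 1)) = log (x + 2) - log (x + 1) := by
    rw [← log_div h2.ne' h1.ne']; congr 1; field_simp; ring
  have l3 : log (1 - 1 / (x + 1)) = log x - log (x + 1) := by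
    rw [← log_div h0.ne' h1.ne']; congr 1; field_simp; ring
  have l4 : log (1 + 1 / x) = log (x + 1) - log x := by
    rw [← log_div h1.ne' h0.ne']; congr 1; field_simp
  have l5 : x + 1 + 1 = x + 2 := by ring
  simp only [Pi.sub_apply, hq, l0, l1, l2, l3, l4, l5]
  generalize Hq (x + 1) = A
  generalize Hq x = B
  field_simp
  ring

lemma Phi_tendsto : Tendsto Phi atTop (𝓝 0) := by
  have i0 : Tendsto (fun x : ℝ => 1 / x) atTop (𝓝[>] 0) := by
    simpa using tendsto_inv_atTop_nhdsGT_zero (𝕜 := ℝ)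
  have i1 : Tendsto (fun x : ℝ => 1 / (x + 1)) atTop (𝓝[>] 0) :=
    i0.comp (tendsto_atTop_add_const_right _ 1 tendsto_id)
  have n0 := Nq_tendsto.comp i0
  have n1 := Nq_tendsto.comp i1
  have hM : ContinuousAt Mq 0 := by
    have e1 := (Fq_comp ((hasDerivAt_id (0:ℝ)).pow 2) (by norm_num)).continuousAt
    have e2 := (Fq_hasDeriv zero_lt_one).continuousAt
    have e3 := (Fq_comp (hasDerivAt_neg (0:ℝ)) (by norm_num)).continuousAt
    exact (((e1.div_const 2).sub e2).sub e3).div_const 2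
  have m1 := (hM.tendsto.mono_left (nhdsWithin_le_nhds (s := Ioi 0))).comp i1
  have hM0 : Mq 0 = 0 := by simp [Mq, Fq_zero]
  rw [hM0] at m1
  have hl : Tendsto (fun x => log x * (Hq (x + 1) - Hq x)) atTop (𝓝 0) := by
    have hm : Tendsto (fun x : ℝ => log x * (1 / x)) atTop (𝓝 0) := by
      have := Real.isLittleO_log_id_atTop.tendsto_div_nhds_zero
      refine this.congr (fun x => ?_)
      simp [div_eq_mul_inv]
    refine squeeze_zero' ?_ ?_ hm
    · filter_upwards [eventually_ge_atTop 1] with x hx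
      rw [Hq_sub (by linarith)]
      refine mul_nonneg (log_nonneg hx) (intervalIntegral.integral_nonneg (by linarith) ?_)
      intro u hu
      exact hq_nonneg (by linarith [hu.1])
    · filter_upwards [eventually_ge_atTop 1] with x hx
      rw [Hq_sub (by linarith)]
      refine mul_le_mul_of_nonneg_left ?_ (log_nonneg hx)
      have := intervalIntegral.norm_integral_le_of_norm_le_const (a := x) (b := x + 1)
        (f := hq) (C := 1 / x) (fun u hu => by
          rw [uIoc_of_le (by linarith)] at hu
          rw [norm_eq_abs, abs_of_nonneg (hq_nonneg (by linarith [hu.1]))]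
          exact hq_le hx hu.1.le)
      simp only [add_sub_cancel_left, abs_one, mul_one] at this
      exact (le_abs_self _).trans this
  have T := ((hl.sub n1).add m1).add n0
  simp only [zero_sub, add_zero, neg_add_cancel] at T
  exact T

lemma inner_eq {x : ℝ} (hx : 1 < x) : (∫ y in Set.Ioo (0:ℝ) 1, ∫ z in Set.Ioo (0:ℝ) 1,
      1 / (x * (x + y) * (x + y + z))) = (Hq (x + 1) - Hq x) / x := by
  have hz : ∀ y ∈ Ioo (0:ℝ) 1, (∫ z in Set.Ioo (0:ℝ) 1, 1 / (x * (x + y) * (x + y + z)))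
      = hq (x + y) / x := by
    intro y hy
    have h0 : 0 < x + y := by linarith [hy.1]
    have e : (fun z : ℝ => 1 / (x * (x + y) * (x + y + z)))
        = fun z => (1 / (x * (x + y))) * (fun t => t⁻¹) (x + y + z) := by
      ext z; simp only; rw [one_div, mul_inv, one_div]
    rw [e, integral_const_mul, ← integral_Ioc_eq_integral_Ioo,
      ← intervalIntegral.integral_of_le zero_le_one,
      intervalIntegral.integral_comp_add_left (fun t : ℝ => t⁻¹) (x + y), add_zero,
      integral_inv_of_pos h0 (by linarith), log_div (by positivity) h0.ne', hq]
    field_simp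
  rw [setIntegral_congr_fun measurableSet_Ioo hz, ← integral_Ioc_eq_integral_Ioo,
    ← intervalIntegral.integral_of_le zero_le_one, intervalIntegral.integral_div,
    intervalIntegral.integral_comp_add_left hq x, Hq_sub (by linarith), add_zero]

theorem triple_integral_eq :
    (∫ x in Set.Ioi (1:ℝ), ∫ y in Set.Ioo (0:ℝ) 1, ∫ z in Set.Ioo (0:ℝ) 1,
      1 / (x * (x + y) * (x + y + z)))
    = (5/24) * ∑' n : ℕ, 1 / ((n:ℝ) + 1) ^ 3 := by
  rw [setIntegral_congr_fun measurableSet_Ioi (fun x hx => inner_eq hx),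
    MeasureTheory.integral_Ioi_of_hasDerivAt_of_nonneg' (fun x hx => Phi_deriv hx) ?_ Phi_tendsto]
  · have hA := Fq_A (b := 1/2) (by norm_num) (by norm_num)
    have hB := Fq_B (b := 1/2) (by norm_num) (by norm_num)
    have hn := Fq_neg (b := 1/2) (by norm_num)
    have hn1 := Fq_neg (b := 1) (by norm_num)
    have q1 := Qq_eq (y := 1) one_pos
    have q2 := Qq_eq (y := 1/2) (by norm_num)
    have h8 := Fq_neg_one
    have hz := Fq_one
    have l1 : log (1/2) = - log 2 := by rw [one_div, log_inv]
    have l2 : log (3/2) = log 3 - log 2 := log_div (by norm_num) (by norm_num)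
    simp only [Phi, Nq, Mq]
    norm_num at hA hB hn hn1 q1 q2 ⊢
    norm_num [l1, l2] at hA hB hn hn1 q1 q2 ⊢
    simp only [one_div] at hz
    linarith
  · intro x hx
    have hx : 1 < x := hx
    rw [Hq_sub (by linarith)]
    refine div_nonneg (intervalIntegral.integral_nonneg (by linarith) ?_) (by linarith)
    intro u hu
    exact hq_nonneg (by linarith [hu.1])
end

section
/- The double sum ∑_{k=1}^∞ ∑_{j=k}^∞ (-1)^{k-1}/(k² · j · 2^j) equals (13/24)·ζ(3). -/
open Set Filter Topology

noncomputable def pLi (s : ℕ) (x : ℝ) : ℝ := ∑' n : ℕ, x ^ (n + 1) / ((n : ℝ) + 1) ^ s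

noncomputable def pP (x : ℝ) : ℝ :=
  2 * pLi 3 x - 2 * (Real.log x * pLi 2 x) - Real.log x ^ 2 * Real.log (1 - x)

noncomputable def pT (k : ℕ) (x : ℝ) : ℝ :=
  -Real.log (1 - x) - ∑ j ∈ Finset.range k, x ^ (j + 1) / ((j : ℝ) + 1)

noncomputable def pF (x : ℝ) : ℝ := ∑' k : ℕ, (-1 : ℝ) ^ k / ((k : ℝ) + 1) ^ 2 * pT k x

lemma const_of_deriv {f : ℝ → ℝ} {a b : ℝ} (hab : a < b) (hc : ContinuousOn f (Icc a b))
    (hd : ∀ x ∈ Ioo a b, HasDerivAt f 0 x) : f b = f a := by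
  obtain ⟨c, _, h⟩ := exists_hasDerivAt_eq_slope f (fun _ => 0) hab hc hd
  have : b - a ≠ 0 := by linarith
  field_simp at h
  linarith

lemma pLi_zero (s : ℕ) : pLi s 0 = 0 := by simp [pLi]

lemma pLi_one {x : ℝ} (hx : |x| < 1) : pLi 1 x = -Real.log (1 - x) := by
  have := (Real.hasSum_pow_div_log_of_abs_lt_one hx).tsum_eq
  simpa [pLi] using this

lemma summable_sq (s : ℕ) (hs : 2 ≤ s) : Summable (fun n : ℕ => 1 / ((n : ℝ) + 1) ^ s) := by
  have := (summable_nat_add_iff 1).2 (Real.summable_one_div_nat_pow.2 (show 1 < s by omega))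
  simpa using this

lemma pLi_cont (s : ℕ) (hs : 2 ≤ s) : ContinuousOn (pLi s) (Icc (-1) 1) := by
  unfold pLi
  refine continuousOn_tsum (u := fun n : ℕ => 1 / ((n : ℝ) + 1) ^ s) (fun n => by fun_prop)
    (summable_sq s hs) ?_
  intro n x hx
  rw [norm_div, norm_pow, norm_pow]
  have h1 : ‖x‖ ≤ 1 := by rw [Real.norm_eq_abs, abs_le]; exact hx
  have h2 : ‖(n : ℝ) + 1‖ = (n : ℝ) + 1 := by
    rw [Real.norm_eq_abs, abs_of_pos]; positivity
  rw [h2]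
  gcongr
  exact pow_le_one₀ (norm_nonneg _) h1

lemma pLi_hasDeriv' (s : ℕ) {x : ℝ} (hx : |x| < 1) :
    HasDerivAt (pLi (s + 1)) (∑' n : ℕ, x ^ n / ((n : ℝ) + 1) ^ s) x := by
  obtain ⟨r, hr1, hr2⟩ := exists_between hx
  have hr0 : 0 ≤ r := (abs_nonneg x).trans hr1.le
  unfold pLi
  refine hasDerivAt_tsum_of_isPreconnected (u := fun n : ℕ => r ^ n)
    (g := fun (n : ℕ) (x : ℝ) => x ^ (n + 1) / ((n : ℝ) + 1) ^ (s + 1))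
    (g' := fun (n : ℕ) (x : ℝ) => x ^ n / ((n : ℝ) + 1) ^ s)
    (t := Ioo (-r) r) (y₀ := 0)
    (summable_geometric_of_lt_one hr0 hr2) isOpen_Ioo isPreconnected_Ioo ?_ ?_ ?_ ?_ ?_
  · intro n y _
    have h := (hasDerivAt_pow (n + 1) y).div_const (((n : ℝ) + 1) ^ (s + 1))
    refine h.congr_deriv ?_
    have : (n : ℝ) + 1 ≠ 0 := by positivity
    push_cast
    try simp only [Nat.add_sub_cancel]
    field_simp
    ring
  · intro n y hy
    rw [norm_div, norm_pow, norm_pow]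
    have h1 : ‖y‖ ≤ r := by rw [Real.norm_eq_abs, abs_le]; exact ⟨hy.1.le, hy.2.le⟩
    have h2 : ‖(n : ℝ) + 1‖ = (n : ℝ) + 1 := by
      rw [Real.norm_eq_abs, abs_of_pos]; positivity
    rw [h2]
    have h3 : (1 : ℝ) ≤ ((n : ℝ) + 1) ^ s := one_le_pow₀ (by linarith [n.cast_nonneg (α := ℝ)])
    calc ‖y‖ ^ n / ((n : ℝ) + 1) ^ s ≤ ‖y‖ ^ n := div_le_self (by positivity) h3
      _ ≤ r ^ n := by gcongr
  · have := (abs_nonneg x).trans_lt hr1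
    constructor <;> linarith
  · simp
  · exact abs_lt.1 hr1

lemma pLi_hasDeriv (s : ℕ) {x : ℝ} (hx : |x| < 1) (h0 : x ≠ 0) :
    HasDerivAt (pLi (s + 1)) (pLi s x / x) x := by
  convert pLi_hasDeriv' s hx using 1
  rw [pLi, ← tsum_div_const]
  congr 1; ext n
  field_simp
  ring

lemma cont_x_log_sq : Continuous (fun x : ℝ => x * Real.log x ^ 2) := by
  rw [continuous_iff_continuousAt]
  intro x
  by_cases hx : x = 0
  · subst hx
    have h : Continuous (fun x : ℝ => 4 * (√|x| * Real.log (√|x|)) ^ 2) := by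
      have := Real.continuous_mul_log.comp (Real.continuous_sqrt.comp (continuous_abs (G := ℝ)))
      exact continuous_const.mul (this.pow 2)
    have h2 := h.tendsto 0
    simp only [abs_zero, Real.sqrt_zero, zero_mul, ne_eq, OfNat.ofNat_ne_zero,
      not_false_eq_true, zero_pow, mul_zero] at h2
    unfold ContinuousAt
    simp only [zero_mul]
    refine squeeze_zero_norm (fun x => ?_) h2
    rw [Real.log_sqrt (abs_nonneg x), mul_pow, Real.sq_sqrt (abs_nonneg x), Real.log_abs, norm_mul,
      Real.norm_eq_abs, Real.norm_eq_abs, abs_of_nonneg (sq_nonneg (Real.log x))]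
    apply le_of_eq; ring
  · fun_prop (disch := assumption)

lemma log_mul_cont {g : ℝ → ℝ} {d : ℝ} (hg : HasDerivAt g d 0) (h0 : g 0 = 0) :
    ContinuousAt (fun x => Real.log x * g x) 0 ∧ ContinuousAt (fun x => Real.log x ^ 2 * g x) 0 := by
  have hd : ContinuousAt (dslope g 0) 0 := continuousAt_dslope_same.2 hg.differentiableAt
  have hx : ∀ x, g x = x * dslope g 0 x := by
    intro x
    have := sub_smul_dslope g 0 x
    simp [h0] at this
    exact this.symm
  constructor
  · have : (fun x => Real.log x * g x) = fun x => (x * Real.log x) * dslope g 0 x := by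
      ext x; rw [hx x]; ring
    rw [this]
    exact Real.continuous_mul_log.continuousAt.mul hd
  · have : (fun x => Real.log x ^ 2 * g x) = fun x => (x * Real.log x ^ 2) * dslope g 0 x := by
      ext x; rw [hx x]; ring
    rw [this]
    exact cont_x_log_sq.continuousAt.mul hd

lemma hd_log1m {x : ℝ} (hx : 1 - x ≠ 0) :
    HasDerivAt (fun x : ℝ => Real.log (1 - x)) (-1 / (1 - x)) x := by
  have := ((hasDerivAt_id x).const_sub 1).log hx
  simpa using this

lemma hd_log1p {x : ℝ} (hx : 1 + x ≠ 0) :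
    HasDerivAt (fun x : ℝ => Real.log (1 + x)) (1 / (1 + x)) x := by
  have := ((hasDerivAt_id x).const_add 1).log hx
  simpa using this

lemma E_cont : Continuous (fun x : ℝ => Real.log x ^ 2 * Real.log (1 - x)) := by
  rw [continuous_iff_continuousAt]
  intro x
  by_cases hx : x = 0
  · subst hx
    exact (log_mul_cont (hd_log1m (x := 0) (by norm_num)) (by simp)).2
  by_cases hx1 : x = 1
  · subst hx1
    have h := (log_mul_cont ((hd_log1m (x := 0) (by norm_num)).pow 2) (by simp)).1
    have h2 : ContinuousAt (fun x : ℝ => 1 - x) 1 := by fun_prop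
    have h3 := ContinuousAt.comp_of_eq (f := fun x : ℝ => 1 - x) h h2 (by norm_num)
    convert h3 using 1
    ext x
    simp [mul_comm]
  · have : 1 - x ≠ 0 := fun h => hx1 (by linarith)
    fun_prop (disch := assumption)

lemma logLi_cont : ContinuousOn (fun x : ℝ => Real.log x * pLi 2 x) (Icc (-1) 1) := by
  intro x hx
  by_cases h0 : x = 0
  · subst h0
    exact (log_mul_cont (pLi_hasDeriv' 1 (x := 0) (by norm_num)) (pLi_zero 2)).1.continuousWithinAt
  · exact (Real.continuousAt_log h0).continuousWithinAt.mul (pLi_cont 2 le_rfl x hx)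

lemma pP_cont : ContinuousOn pP (Icc (-1) 1) := by
  unfold pP
  exact ((continuousOn_const.mul (pLi_cont 3 (by norm_num))).sub
    (continuousOn_const.mul logLi_cont)).sub E_cont.continuousOn

lemma pP_zero : pP 0 = 0 := by simp [pP, pLi_zero]

lemma pP_one : pP 1 = 2 * ∑' n : ℕ, 1 / ((n:ℝ) + 1) ^ 3 := by simp [pP, pLi]

lemma pP_deriv {x : ℝ} (hx : |x| < 1) (h0 : x ≠ 0) :
    HasDerivAt pP (Real.log x ^ 2 / (1 - x)) x := by
  have h1 : 1 - x ≠ 0 := by have := (abs_lt.1 hx).2; linarith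
  have hl := Real.hasDerivAt_log h0
  have h := (((pLi_hasDeriv 2 hx h0).const_mul 2).sub
    ((hl.mul (pLi_hasDeriv 1 hx h0)).const_mul 2)).sub ((hl.pow 2).mul (hd_log1m h1))
  refine h.congr_deriv ?_
  rw [pLi_one hx]
  simp only [Pi.pow_apply]
  field_simp
  ring

/-- chain rule -/
lemma pP_comp {u : ℝ → ℝ} {u' x : ℝ} (hu : HasDerivAt u u' x) (h1 : |u x| < 1) (h0 : u x ≠ 0) :
    HasDerivAt (fun x => pP (u x)) (Real.log (u x) ^ 2 / (1 - u x) * u') x :=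
  (pP_deriv h1 h0).comp x hu

lemma dup {b : ℝ} (hb0 : 0 < b) (hb1 : b ≤ 1) : pP (b ^ 2) = 4 * pP b + 4 * pP (-b) := by
  have key := const_of_deriv (f := fun x => pP (x ^ 2) - 4 * pP x - 4 * pP (-x)) hb0 ?_ ?_
  · simp [pP_zero] at key; linarith
  · refine ((pP_cont.comp (by fun_prop) ?_).sub (continuousOn_const.mul (pP_cont.mono ?_))).sub
      (continuousOn_const.mul (pP_cont.comp (by fun_prop) ?_))
    · intro x hx; constructor <;> nlinarith [hx.1, hx.2]
    · intro x hx; constructor <;> linarith [hx.1, hx.2]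
    · intro x hx; constructor <;> linarith [hx.1, hx.2]
  · intro x hx
    obtain ⟨hx0, hxb⟩ := hx
    have hx1 : x < 1 := by linarith
    have e1 := pP_comp (u := fun x => x ^ 2) (hasDerivAt_pow 2 x)
      (by rw [abs_lt]; constructor <;> nlinarith) (by positivity)
    have e2 := pP_deriv (x := x) (by rw [abs_lt]; constructor <;> linarith) hx0.ne'
    have e3 := pP_comp (u := fun x => -x) (hasDerivAt_neg x)
      (by rw [abs_lt]; constructor <;> linarith) (by simpa using hx0.ne')
    refine ((e1.sub (e2.const_mul 4)).sub (e3.const_mul 4)).congr_deriv ?_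
    simp only [Real.log_pow, Real.log_neg_eq_log]
    have : 1 - x ≠ 0 := by linarith
    have : 1 + x ≠ 0 := by linarith
    have h3 : 1 - x ^ 2 = (1 - x) * (1 + x) := by ring
    rw [h3, sub_neg_eq_add]
    push_cast
    field_simp
    ring

lemma landen {b : ℝ} (hb0 : 0 < b) (hb1 : b ≤ 1 / 2) :
    pP b + pP (1 - b) + pP (-(b / (1 - b))) =
      pP 1 - Real.log b * Real.log (1 - b) ^ 2 + Real.log (1 - b) ^ 3 / 3 := by
  have key := const_of_deriv (f := fun x => pP x + pP (1 - x) + pP (-(x / (1 - x)))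
    + Real.log (1 - x) ^ 2 * Real.log (1 - (1 - x)) - Real.log (1 - x) ^ 3 / 3) hb0 ?_ ?_
  · simp [pP_zero] at key; linarith
  · have hne : ∀ x ∈ Icc 0 b, 1 - x ≠ 0 := fun x hx => by linarith [hx.2]
    refine ((((pP_cont.mono ?_).add (pP_cont.comp (by fun_prop) ?_)).add
      (pP_cont.comp (f := fun x : ℝ => -(x / (1 - x))) ?_ ?_)).add
      (E_cont.comp (f := fun x : ℝ => 1 - x) (by fun_prop)).continuousOn).sub ?_
    · intro x hx; constructor <;> linarith [hx.1, hx.2]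
    · intro x hx; constructor <;> linarith [hx.1, hx.2]
    · exact (continuousOn_id.div (by fun_prop) hne).neg
    · intro x hx
      have h1 : 0 < 1 - x := by linarith [hx.2]
      have h2 : x / (1 - x) ≤ 1 := by rw [div_le_one h1]; linarith [hx.2]
      have h3 : 0 ≤ x / (1 - x) := div_nonneg hx.1 h1.le
      constructor <;> linarith
    · exact ((ContinuousOn.log (by fun_prop) hne).pow 3).div_const 3
  · intro x hx
    obtain ⟨hx0, hxb⟩ := hx
    have h1 : 0 < 1 - x := by linarith
    have h1n := h1.ne'
    have hq1 : x / (1 - x) < 1 := by rw [div_lt_one h1]; linarith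
    have hq0 : 0 < x / (1 - x) := div_pos hx0 h1
    have e1 := pP_deriv (x := x) (by rw [abs_lt]; constructor <;> linarith) hx0.ne'
    have d2 := (hasDerivAt_id x).const_sub 1
    have e2 := pP_comp (u := fun x => 1 - x) d2
      (by rw [abs_lt]; constructor <;> linarith) h1n
    have e3 := pP_comp (u := fun x => -(x / (1 - x))) ((hasDerivAt_id x).div d2 h1n).neg
      (by rw [abs_lt]; constructor <;> linarith) (by simpa using ⟨hx0.ne', h1n⟩)
    have e4 : HasDerivAt (fun x : ℝ => Real.log (1 - (1 - x))) (1 / x) x := by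
      simpa using Real.hasDerivAt_log hx0.ne'
    have l1 := hd_log1m h1n
    refine ((((e1.add e2).add e3).add ((l1.pow 2).mul e4)).sub ((l1.pow 3).div_const 3)).congr_deriv ?_
    simp only [Pi.pow_apply, Real.log_neg_eq_log, Real.log_div hx0.ne' h1n, sub_sub_cancel, id]
    have h5 : 1 - -(x / (1 - x)) = 1 / (1 - x) := by field_simp; ring
    rw [h5]
    push_cast
    field_simp
    ring

lemma pT_deriv (k : ℕ) {x : ℝ} (hx : x < 1) : HasDerivAt (pT k) (x ^ k / (1 - x)) x := by
  have h1 : 1 - x ≠ 0 := by linarith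
  have hs : HasDerivAt (fun x : ℝ => ∑ j ∈ Finset.range k, x ^ (j + 1) / ((j : ℝ) + 1))
      (∑ j ∈ Finset.range k, x ^ j) x := by
    refine HasDerivAt.fun_sum fun j _ => ?_
    refine ((hasDerivAt_pow (j + 1) x).div_const ((j : ℝ) + 1)).congr_deriv ?_
    have : (j : ℝ) + 1 ≠ 0 := by positivity
    push_cast
    try simp only [Nat.add_sub_cancel]
    field_simp
  refine ((hd_log1m h1).neg.sub hs).congr_deriv ?_
  rw [geom_sum_eq (by linarith)]
  have : x - 1 ≠ 0 := by linarith
  rw [eq_comm, ← sub_eq_zero]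
  have h2 : x - 1 = -(1 - x) := by ring
  rw [h2]
  field_simp
  ring

lemma pF_deriv {x : ℝ} (h0 : -(3/4) < x) (h1 : x < 3/4) :
    HasDerivAt pF (∑' k : ℕ, (-1 : ℝ) ^ k / ((k : ℝ) + 1) ^ 2 * (x ^ k / (1 - x))) x := by
  unfold pF
  refine hasDerivAt_tsum_of_isPreconnected (u := fun n : ℕ => 1 / ((n : ℝ) + 1) ^ 2 * 4)
    (g := fun (k : ℕ) (x : ℝ) => (-1 : ℝ) ^ k / ((k : ℝ) + 1) ^ 2 * pT k x)
    (g' := fun (k : ℕ) (x : ℝ) => (-1 : ℝ) ^ k / ((k : ℝ) + 1) ^ 2 * (x ^ k / (1 - x)))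
    (t := Ioo (-(3/4) : ℝ) (3/4)) (y₀ := 0)
    ((summable_sq 2 le_rfl).mul_right 4) isOpen_Ioo isPreconnected_Ioo ?_ ?_ ?_ ?_ ?_
  · intro n y hy
    exact (pT_deriv n (by linarith [hy.2])).const_mul _
  · intro n y hy
    have h2 : ‖(n : ℝ) + 1‖ = (n : ℝ) + 1 := by
      rw [Real.norm_eq_abs, abs_of_pos]; positivity
    have h3 : 0 < 1 - y := by linarith [hy.2]
    have h4 : ‖1 - y‖ = 1 - y := by rw [Real.norm_eq_abs, abs_of_pos h3]
    rw [norm_mul, norm_div, norm_div, norm_pow, norm_pow, norm_pow, h2, h4]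
    simp only [norm_neg, norm_one, one_pow]
    gcongr
    have h5 : ‖y‖ ≤ 1 := by
      rw [Real.norm_eq_abs, abs_le]; constructor <;> linarith [hy.1, hy.2]
    rw [div_le_iff₀ h3]
    have := pow_le_one₀ (n := n) (norm_nonneg y) h5
    linarith [hy.2]
  · norm_num
  · simp [pT]
  · exact ⟨h0, h1⟩

lemma pF_deriv' {x : ℝ} (h0 : 0 < x) (h1 : x < 3/4) :
    HasDerivAt pF (-pLi 2 (-x) / (x * (1 - x))) x := by
  refine (pF_deriv (by linarith) h1).congr_deriv ?_
  rw [pLi, ← tsum_neg, ← tsum_div_const]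
  congr 1; ext k
  have : 1 - x ≠ 0 := by linarith
  have h : (-x) ^ (k + 1) = (-1) ^ k * x ^ k * (-x) := by rw [pow_succ, ← mul_pow]; simp
  rw [h]
  field_simp

lemma pF_zero : pF 0 = 0 := by simp [pF, pT]

lemma lhs_eq : (∑' k : ℕ, ∑' j : ℕ,
      (-1:ℝ) ^ k / (((k:ℝ) + 1) ^ 2 * ((j:ℝ) + (k:ℝ) + 1) * 2 ^ (j + k + 1))) = pF (1/2) := by
  unfold pF
  congr 1; ext k
  have hs := Real.hasSum_pow_div_log_of_abs_lt_one (x := 1/2) (by rw [abs_lt]; norm_num)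
  have h := hs.summable.sum_add_tsum_nat_add k
  rw [hs.tsum_eq] at h
  have hT : pT k (1/2) = ∑' i : ℕ, (1/2 : ℝ) ^ (i + k + 1) / (((i + k : ℕ) : ℝ) + 1) := by
    unfold pT; linarith
  rw [hT, ← tsum_mul_left]
  congr 1; ext j
  have : (j : ℝ) + k + 1 ≠ 0 := by positivity
  push_cast
  rw [one_div, inv_pow]
  field_simp

lemma main_half : pF (1/2) = -(1/2) * (Real.log (1/2) ^ 2 * Real.log (3/2)) - 1/2 * pP (-(1/2))
    + 1/3 * (-(1/2) * pP (3/4) + pP (1/3) - pP (-(1/3)))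
    - 1/6 * (-pP (1/2) - pP (2/3) + Real.log (3/2) ^ 3 / 3 + pP (1/3) - pP (-(1/3)))
    - (1/3 * (-(1/2) * pP 1 + pP 1 - pP (-1)) - 1/6 * (-pP 1 - pP 1 + pP 1 - pP (-1))) := by
  have key := const_of_deriv (f := fun x => pF x
    + (Real.log x * pLi 2 (-x) - Real.log (1 - x) * pLi 2 (-x))
    + 1/2 * (Real.log x ^ 2 * Real.log (1 + x)) + 1/2 * pP (-x)
    - 1/3 * (-(1/2) * pP (1 - x^2) + pP ((1-x)/(1+x)) - pP (-((1-x)/(1+x))))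
    + 1/6 * (-pP (1 - x) - pP (1/(1+x)) + Real.log (1 + x) ^ 3 / 3
      + pP ((1-x)/(1+x)) - pP (-((1-x)/(1+x)))))
    (show (0:ℝ) < 1/2 by norm_num) ?_ ?_
  · have hl : Real.log (1 - 1/2) = Real.log (1/2) := by norm_num
    simp only [hl] at key
    norm_num [pP_zero, pF_zero, pLi_zero] at key
    norm_num
    linarith
  · have hp : ∀ x ∈ Icc (0:ℝ) (1/2), 1 + x ≠ 0 := fun x hx => by linarith [hx.1]
    have hm : ∀ x ∈ Icc (0:ℝ) (1/2), 1 - x ≠ 0 := fun x hx => by linarith [hx.2]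
    have hy : ContinuousOn (fun x : ℝ => (1-x)/(1+x)) (Icc 0 (1/2)) :=
      ContinuousOn.div (by fun_prop) (by fun_prop) hp
    have hyb : ∀ x ∈ Icc (0:ℝ) (1/2), 0 ≤ (1-x)/(1+x) ∧ (1-x)/(1+x) ≤ 1 := fun x hx => by
      have : 0 < 1 + x := by linarith [hx.1]
      exact ⟨div_nonneg (by linarith [hx.2]) this.le, by rw [div_le_one this]; linarith [hx.1]⟩
    have hneg : MapsTo (fun x : ℝ => -x) (Icc (0:ℝ) (1/2)) (Icc (-1) 1) := fun x hx => by
      constructor <;> linarith [hx.1, hx.2]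
    have c1 : ContinuousOn pF (Icc (0:ℝ) (1/2)) := fun x hx =>
      (pF_deriv (x := x) (by linarith [hx.1]) (by linarith [hx.2])).continuousAt.continuousWithinAt
    have c2 : ContinuousOn (fun x : ℝ => Real.log x * pLi 2 (-x)) (Icc (0:ℝ) (1/2)) := by
      have := logLi_cont.comp (f := fun x : ℝ => -x) (s := Icc (0:ℝ) (1/2)) (by fun_prop) hneg
      refine this.congr fun x _ => ?_
      simp
    have c3 : ContinuousOn (fun x : ℝ => Real.log (1 - x) * pLi 2 (-x)) (Icc (0:ℝ) (1/2)) :=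
      (ContinuousOn.log (by fun_prop) hm).mul ((pLi_cont 2 le_rfl).comp (by fun_prop) hneg)
    have c4 : ContinuousOn (fun x : ℝ => Real.log x ^ 2 * Real.log (1 + x)) (Icc (0:ℝ) (1/2)) := by
      have := (E_cont.comp (continuous_neg (G := ℝ))).continuousOn (s := Icc (0:ℝ) (1/2))
      refine this.congr fun x _ => ?_
      simp
    have c5 : ContinuousOn (fun x : ℝ => pP (-x)) (Icc (0:ℝ) (1/2)) :=
      pP_cont.comp (by fun_prop) hneg
    have c6 : ContinuousOn (fun x : ℝ => pP (1 - x^2)) (Icc (0:ℝ) (1/2)) :=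
      pP_cont.comp (by fun_prop) fun x hx => by constructor <;> nlinarith [hx.1, hx.2]
    have c7 : ContinuousOn (fun x : ℝ => pP ((1-x)/(1+x))) (Icc (0:ℝ) (1/2)) :=
      pP_cont.comp hy fun x hx => ⟨by linarith [(hyb x hx).1], (hyb x hx).2⟩
    have c8 : ContinuousOn (fun x : ℝ => pP (-((1-x)/(1+x)))) (Icc (0:ℝ) (1/2)) :=
      pP_cont.comp hy.neg fun x hx => ⟨by linarith [(hyb x hx).2], by linarith [(hyb x hx).1]⟩
    have c9 : ContinuousOn (fun x : ℝ => pP (1 - x)) (Icc (0:ℝ) (1/2)) :=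
      pP_cont.comp (by fun_prop) fun x hx => by constructor <;> linarith [hx.1, hx.2]
    have c10 : ContinuousOn (fun x : ℝ => pP (1/(1+x))) (Icc (0:ℝ) (1/2)) :=
      pP_cont.comp (ContinuousOn.div (by fun_prop) (by fun_prop) hp) fun x hx => by
        have : 0 < 1 + x := by linarith [hx.1]
        have h2 : 0 < 1 / (1 + x) := by positivity
        exact ⟨by linarith, by rw [div_le_one this]; linarith [hx.1]⟩
    have c11 : ContinuousOn (fun x : ℝ => Real.log (1 + x)) (Icc (0:ℝ) (1/2)) :=
      ContinuousOn.log (by fun_prop) hp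
    fun_prop
  · intro x hx
    obtain ⟨hx0, hxb⟩ := hx
    have hx0n := hx0.ne'
    have hm : 0 < 1 - x := by linarith
    have hp : 0 < 1 + x := by linarith
    have hmn := hm.ne'
    have hpn := hp.ne'
    have hy0 : 0 < (1-x)/(1+x) := div_pos hm hp
    have hy1 : (1-x)/(1+x) < 1 := by rw [div_lt_one hp]; linarith
    have hz0 : 0 < 1/(1+x) := by positivity
    have hz1 : 1/(1+x) < 1 := by rw [div_lt_one hp]; linarith
    have la := Real.hasDerivAt_log hx0n
    have lb := hd_log1m hmn
    have lc := hd_log1p hpn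
    have hab : |-x| < 1 := by rw [abs_lt]; constructor <;> linarith
    have dLi := (pLi_hasDeriv 1 (x := -x) hab (by simpa using hx0n)).comp x (hasDerivAt_neg x)
    rw [pLi_one hab, sub_neg_eq_add] at dLi
    have dm := (hasDerivAt_id x).const_sub 1
    have dp := (hasDerivAt_id x).const_add 1
    have dy := dm.div dp hpn
    have e5 := pP_comp (u := fun x => -x) (hasDerivAt_neg x) hab (by simpa using hx0n)
    have e6 := pP_comp (u := fun x => 1 - x ^ 2) ((hasDerivAt_pow 2 x).const_sub 1)
      (by rw [abs_lt]; constructor <;> nlinarith) (by nlinarith)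
    have e7 := pP_comp (u := fun x => (1-x)/(1+x)) dy
      (by rw [abs_lt]; constructor <;> linarith) hy0.ne'
    have e8 := pP_comp (u := fun x => -((1-x)/(1+x))) dy.neg
      (by rw [abs_lt]; constructor <;> linarith) (by linarith)
    have e9 := pP_comp (u := fun x => 1 - x) dm
      (by rw [abs_lt]; constructor <;> linarith) hmn
    have e10 := pP_comp (u := fun x => 1/(1+x)) ((hasDerivAt_const x (1:ℝ)).div dp hpn)
      (by rw [abs_lt]; constructor <;> linarith) hz0.ne'
    have h := ((((((pF_deriv' hx0 (by linarith)).add ((la.mul dLi).sub (lb.mul dLi))).add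
      (((la.pow 2).mul lc).const_mul (1/2))).add (e5.const_mul (1/2))).sub
      ((((e6.const_mul (-(1/2))).add e7).sub e8).const_mul (1/3))).add
      (((((e9.neg.sub e10).add ((lc.pow 3).div_const 3)).add e7).sub e8).const_mul (1/6)))
    refine h.congr_deriv ?_
    have f1 : 1 - x ^ 2 = (1 - x) * (1 + x) := by ring
    have f2 : 1 - -((1-x)/(1+x)) = 2 / (1 + x) := by field_simp; ring
    have f3 : 1 - (1-x)/(1+x) = 2 * x / (1 + x) := by field_simp; ring
    have f4 : 1 - 1/(1+x) = x / (1 + x) := by field_simp; ring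
    have f5 : 1 - (1 - x^2) = x^2 := by ring
    simp only [Pi.pow_apply, Function.comp, f2, f3, f4, f5, Real.log_neg_eq_log, id]
    rw [f1, Real.log_mul hmn hpn, Real.log_div hmn hpn, Real.log_div one_ne_zero hpn, Real.log_one]
    simp only [sub_sub_cancel, sub_neg_eq_add]
    generalize Real.log (1 + x) = c
    generalize Real.log (1 - x) = b
    generalize Real.log x = a
    generalize pLi 2 (-x) = l
    push_cast
    field_simp
    ring

theorem double_sum_alt_eq :
    (∑' k : ℕ, ∑' j : ℕ,
      (-1:ℝ) ^ k / (((k:ℝ) + 1) ^ 2 * ((j:ℝ) + (k:ℝ) + 1) * 2 ^ (j + k + 1)))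
    = (13/24) * ∑' n : ℕ, 1 / ((n:ℝ) + 1) ^ 3 := by
  rw [lhs_eq, main_half]
  have h1 := pP_one
  have d1 := dup one_pos le_rfl
  have d2 := dup (b := 1/2) (by norm_num) (by norm_num)
  have l1 := landen (b := 1/3) (by norm_num) (by norm_num)
  have l2 := landen (b := 1/4) (by norm_num) (by norm_num)
  have l3 := landen (b := 1/2) (by norm_num) (by norm_num)
  have g1 : Real.log (1/2) = -Real.log 2 := by rw [one_div, Real.log_inv]
  have g2 : Real.log (1/3) = -Real.log 3 := by rw [one_div, Real.log_inv]
  have g3 : Real.log (1/4) = -(2 * Real.log 2) := by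
    rw [one_div, Real.log_inv, show (4:ℝ) = 2 ^ 2 by norm_num, Real.log_pow]; norm_num
  have g4 : Real.log (3/2) = Real.log 3 - Real.log 2 := Real.log_div (by norm_num) (by norm_num)
  have g5 : Real.log (2/3) = Real.log 2 - Real.log 3 := Real.log_div (by norm_num) (by norm_num)
  have g6 : Real.log (3/4) = Real.log 3 - 2 * Real.log 2 := by
    rw [Real.log_div (by norm_num) (by norm_num), show (4:ℝ) = 2 ^ 2 by norm_num, Real.log_pow]
    norm_num
  rw [show (1:ℝ) - 1/3 = 2/3 by norm_num, show -((1:ℝ)/3 / (2/3)) = -(1/2) by norm_num, g2, g5] at l1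
  rw [show (1:ℝ) - 1/4 = 3/4 by norm_num, show -((1:ℝ)/4 / (3/4)) = -(1/3) by norm_num, g3, g6] at l2
  rw [show (1:ℝ) - 1/2 = 1/2 by norm_num, show -((1:ℝ)/2 / (1/2)) = -1 by norm_num, g1] at l3
  rw [show ((1:ℝ)/2)^2 = 1/4 by norm_num] at d2
  rw [one_pow] at d1
  rw [g1, g4]
  generalize (∑' n : ℕ, 1 / ((n:ℝ) + 1) ^ 3) = z at *
  ring_nf at *
  linarith
end

section
/- The double sum ∑_{k=1}^∞ ∑_{j=k}^∞ 1/(k² · j · 2^j) equals (5/8)·ζ(3). -/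
open MeasureTheory Set

theorem cont1 : ContinuousOn (fun u : ℝ => u * Real.log u ^ 2) (Icc 0 1) := by
  have h : Continuous (fun u : ℝ => 4 * (√u * Real.log (√u))^2) := by
    have := Real.continuous_mul_log.comp Real.continuous_sqrt
    exact continuous_const.mul (this.pow 2)
  refine h.continuousOn.congr ?_
  intro u hu
  simp only
  rw [Real.log_sqrt hu.1, mul_pow, Real.sq_sqrt hu.1]; ring

theorem lint_of_deriv {F f : ℝ → ℝ} (hc : ContinuousOn F (Icc 0 1))
    (hd : ∀ x ∈ Ioo (0:ℝ) 1, HasDerivAt F (f x) x) (hf : ∀ x ∈ Ioo (0:ℝ) 1, 0 ≤ f x) :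
    ∫⁻ u in Ioo (0:ℝ) 1, ENNReal.ofReal (f u) = ENNReal.ofReal (F 1 - F 0) := by
  have hi := intervalIntegral.integrableOn_deriv_of_nonneg hc hd hf
  have h2 := intervalIntegral.integral_eq_sub_of_hasDerivAt_of_le zero_le_one hc hd
    ((intervalIntegrable_iff_integrableOn_Ioc_of_le zero_le_one).2 hi)
  rw [← h2, intervalIntegral.integral_of_le zero_le_one, integral_Ioc_eq_integral_Ioo,
    ofReal_integral_eq_lintegral_ofReal]
  · exact hi.mono_set Ioo_subset_Ioc_self
  · exact (ae_restrict_iff' measurableSet_Ioo).2 (Filter.Eventually.of_forall hf)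

theorem I1 (n : ℕ) : ∫⁻ u in Ioo (0:ℝ) 1, ENNReal.ofReal (u^n * (-Real.log u))
    = ENNReal.ofReal (1/((n:ℝ)+1)^2) := by
  have hn : (n:ℝ)+1 ≠ 0 := by positivity
  rw [lint_of_deriv (F := fun u => u^n * (-(u * Real.log u)/(n+1) + u/(n+1)^2))]
  · simp
  · have := Real.continuous_mul_log
    exact ((continuous_pow n).mul (((this.neg).div_const _).add (continuous_id.div_const _))).continuousOn
  · intro x hx
    have hx0 : x ≠ 0 := hx.1.ne'
    have h := ((hasDerivAt_pow (n+1) x).mul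
      (((Real.hasDerivAt_log hx0).neg.div_const ((n:ℝ)+1)).add_const (1/((n:ℝ)+1)^2)))
    refine (h.congr_deriv ?_).congr_of_eventuallyEq (Filter.Eventually.of_forall fun u => ?_)
    · simp only [Pi.neg_apply, Nat.add_sub_cancel]; push_cast; field_simp; ring
    · simp only [Pi.mul_apply, Pi.neg_apply]; ring
  · intro x hx
    have := Real.log_nonpos hx.1.le hx.2.le
    have := pow_nonneg hx.1.le n
    apply mul_nonneg <;> linarith

theorem I2 (n : ℕ) : ∫⁻ u in Ioo (0:ℝ) 1, ENNReal.ofReal (u^n * (Real.log u)^2)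
    = ENNReal.ofReal (2/((n:ℝ)+1)^3) := by
  have hn : (n:ℝ)+1 ≠ 0 := by positivity
  rw [lint_of_deriv (F := fun u => u^n * ((u * Real.log u^2)/(n+1) + (-2/(n+1)^2) * (u * Real.log u) + 2/(n+1)^3*u))]
  · simp
  · have := Real.continuous_mul_log.continuousOn (s := Icc (0:ℝ) 1)
    exact ((continuous_pow n).continuousOn.mul (((cont1.div_const _).add (continuousOn_const.mul this)).add (continuousOn_const.mul continuousOn_id)))
  · intro x hx
    have hx0 : x ≠ 0 := hx.1.ne'
    have hl := Real.hasDerivAt_log hx0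
    have h := ((hasDerivAt_pow (n+1) x).mul
      ((((hl.pow 2).div_const ((n:ℝ)+1)).add (hl.const_mul (-2/((n:ℝ)+1)^2))).add_const (2/((n:ℝ)+1)^3)))
    refine (h.congr_deriv ?_).congr_of_eventuallyEq (Filter.Eventually.of_forall fun u => ?_)
    · simp only [Pi.add_apply, Pi.pow_apply, Nat.add_sub_cancel]; push_cast; field_simp; ring
    · simp only [Pi.mul_apply, Pi.add_apply, Pi.pow_apply]; ring
  · intro x hx
    have := pow_nonneg hx.1.le n
    positivity

theorem J1 : ∫⁻ u in Ioo (0:ℝ) 1, ENNReal.ofReal ((Real.log u)^2/(1-u))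
    = ∑' n : ℕ, ENNReal.ofReal (2/((n:ℝ)+1)^3) := by
  simp_rw [← I2]
  rw [← lintegral_tsum (by intro i; fun_prop)]
  refine setLIntegral_congr_fun measurableSet_Ioo ?_
  intro u hu
  have h := (hasSum_geometric_of_lt_one hu.1.le hu.2).mul_right (Real.log u^2)
  simp only
  rw [← ENNReal.ofReal_tsum_of_nonneg _ h.summable, h.tsum_eq, div_eq_inv_mul]
  intro n
  have := pow_nonneg hu.1.le n
  positivity

theorem J2 : ∫⁻ u in Ioo (0:ℝ) 1, ENNReal.ofReal ((Real.log u)^2/(1-u^2))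
    = ∑' n : ℕ, ENNReal.ofReal (2/((2*n:ℕ)+1:ℝ)^3) := by
  simp_rw [← I2]
  rw [← lintegral_tsum (by intro i; fun_prop)]
  refine setLIntegral_congr_fun measurableSet_Ioo ?_
  intro u hu
  have hu2 : u^2 < 1 := by nlinarith [hu.1, hu.2]
  have h := (hasSum_geometric_of_lt_one (sq_nonneg u) hu2).mul_right (Real.log u^2)
  simp only [pow_mul]
  rw [← ENNReal.ofReal_tsum_of_nonneg _ h.summable, h.tsum_eq, div_eq_inv_mul]
  intro n
  positivity

theorem K1 : ∫⁻ t in Ioo (0:ℝ) 1, ENNReal.ofReal (2 * ((Real.log (1-t^2))^2/t))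
    = ∫⁻ u in Ioo (0:ℝ) 1, ENNReal.ofReal ((Real.log u)^2/(1-u)) := by
  have him : (fun t : ℝ => 1 - t^2) '' Ioo 0 1 = Ioo 0 1 := by
    ext y; constructor
    · rintro ⟨t, ht, rfl⟩
      constructor <;> simp only <;> nlinarith [ht.1, ht.2]
    · intro hy
      refine ⟨√(1-y), ⟨Real.sqrt_pos.2 (by linarith [hy.2]), ?_⟩, ?_⟩
      · rw [Real.sqrt_lt' one_pos]; linarith [hy.1]
      · simp only; rw [Real.sq_sqrt (by linarith [hy.2])]; ring
  conv_rhs => rw [← him]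
  rw [lintegral_image_eq_lintegral_abs_deriv_mul (f' := fun t => -(2*t)) measurableSet_Ioo]
  · refine setLIntegral_congr_fun measurableSet_Ioo ?_
    intro t ht
    have := ht.1
    simp only
    rw [← ENNReal.ofReal_mul (abs_nonneg _), abs_neg, abs_of_pos (by linarith)]
    congr 1
    field_simp
    ring
  · intro x hx
    have := (hasDerivAt_pow 2 x).const_sub 1
    simpa using this.hasDerivWithinAt
  · intro x hx y hy h
    simp only at h
    nlinarith [hx.1, hy.1]

theorem K2 : ∫⁻ t in Ioo (0:ℝ) 1, ENNReal.ofReal ((Real.log ((1-t)/(1+t)))^2/t)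
    = 2 * ∫⁻ u in Ioo (0:ℝ) 1, ENNReal.ofReal ((Real.log u)^2/(1-u^2)) := by
  have him : (fun t : ℝ => (1-t)/(1+t)) '' Ioo 0 1 = Ioo 0 1 := by
    have key : ∀ t ∈ Ioo (0:ℝ) 1, (1-t)/(1+t) ∈ Ioo (0:ℝ) 1 := by
      intro t ht
      have := ht.1
      have := ht.2
      exact ⟨by apply div_pos <;> linarith, by rw [div_lt_one] <;> linarith⟩
    ext y; constructor
    · rintro ⟨t, ht, rfl⟩
      exact key t ht
    · intro hy
      refine ⟨_, key y hy, ?_⟩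
      have := hy.1
      have := hy.2
      simp only
      field_simp
      ring
  conv_rhs => rw [← him]
  rw [lintegral_image_eq_lintegral_abs_deriv_mul (f' := fun t => -(2/(1+t)^2)) measurableSet_Ioo,
    ← lintegral_const_mul' _ _ (by simp)]
  · refine setLIntegral_congr_fun measurableSet_Ioo ?_
    intro t ht
    have := ht.1
    simp only
    have h2 : (2:ENNReal) = ENNReal.ofReal 2 := by simp
    rw [← ENNReal.ofReal_mul (abs_nonneg _), abs_neg, abs_of_pos (by positivity), h2,
      ← ENNReal.ofReal_mul (by norm_num)]
    congr 1
    have h1 : 1 - ((1-t)/(1+t))^2 = 4*t/(1+t)^2 := by field_simp; ring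
    rw [h1]
    field_simp
    ring
  · intro x hx
    have hx0 : 1 + x ≠ 0 := by linarith [hx.1]
    have := ((hasDerivAt_id x).const_sub 1).div ((hasDerivAt_id x).const_add 1) hx0
    refine (this.congr_deriv ?_).hasDerivWithinAt
    simp only [id]; field_simp; ring
  · intro x hx y hy h
    have := hx.1
    have := hy.1
    simp only at h
    field_simp at h
    linarith

theorem HasSum.congr_fun_val {f g : ℕ → ℝ} {a b : ℝ} (h : HasSum f a)
    (hf : ∀ n, g n = f n) (hb : b = a) : HasSum g b := by
  rw [hb, funext hf]; exact h

theorem pw (u : ℝ) (hu : u ∈ Ioo (0:ℝ) 1) :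
    ∑' k : ℕ, ∑' j : ℕ, ENNReal.ofReal (u^k * (1 / (((j:ℝ)+k+1) * 2^(j+k+1))))
     = ENNReal.ofReal (Real.log (2-u)/(1-u)) := by
  have h1 : HasSum (fun n : ℕ => (∑ k ∈ Finset.range (n+1), u^k) * (1/(((n:ℝ)+1)*2^(n+1))))
      (Real.log (2-u)/(1-u)) := by
    have ha := Real.hasSum_pow_div_log_of_abs_lt_one (x := 1/2) (by rw [abs_lt]; norm_num)
    have hb := Real.hasSum_pow_div_log_of_abs_lt_one (x := u/2)
      (by rw [abs_lt]; constructor <;> linarith [hu.1, hu.2])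
    have hc := (ha.sub hb).div_const (1-u)
    have h1u : 1 - u ≠ 0 := by linarith [hu.2]
    have hu1 : u - 1 ≠ 0 := by linarith [hu.2]
    refine (hc.congr_fun_val ?_ ?_)
    · intro n
      rw [geom_sum_eq (by linarith [hu.2]), div_pow, div_pow]
      have : (n:ℝ)+1 ≠ 0 := by positivity
      field_simp
      ring
    · have : (2 - u) = (1-u/2) / (1-1/2) := by ring
      rw [this, Real.log_div (by linarith [hu.2]) (by norm_num)]
      ring
  rw [← h1.tsum_eq, ENNReal.ofReal_tsum_of_nonneg _ h1.summable]
  swap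
  · intro n
    have := hu.1
    positivity
  rw [← ENNReal.tsum_prod (f := fun k j : ℕ => ENNReal.ofReal (u^k * (1 / (((j:ℝ)+k+1) * 2^(j+k+1))))),
    ← Finset.HasAntidiagonal.sigmaAntidiagonalEquivProd.tsum_eq, ENNReal.tsum_sigma']
  congr 1
  ext n
  rw [tsum_fintype]
  have := hu.1
  rw [Finset.sum_mul, ENNReal.ofReal_sum_of_nonneg (by intros; positivity)]
  rw [← Finset.Nat.sum_antidiagonal_eq_sum_range_succ_mk (f := fun p : ℕ × ℕ => ENNReal.ofReal (u^p.1 * (1/(((n:ℝ)+1)*2^(n+1)))))]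
  rw [← Finset.sum_coe_sort (Finset.HasAntidiagonal.antidiagonal n)]
  refine Finset.sum_congr rfl ?_
  rintro ⟨⟨a, b⟩, hab⟩ -
  rw [Finset.HasAntidiagonal.mem_antidiagonal] at hab
  simp only at hab
  subst hab
  simp only [Finset.HasAntidiagonal.sigmaAntidiagonalEquivProd_apply]
  push_cast
  rw [add_comm a b, add_comm (a:ℝ) b]

theorem S_eq : ∑' k : ℕ, ∑' j : ℕ,
      ENNReal.ofReal ((1:ℝ) / (((k:ℝ) + 1) ^ 2 * ((j:ℝ) + (k:ℝ) + 1) * 2 ^ (j + k + 1)))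
    = ∫⁻ t in Ioo (0:ℝ) 1, ENNReal.ofReal (-(Real.log (1-t) * Real.log (1+t))/t) := by
  have e : ∀ k j : ℕ, ENNReal.ofReal ((1:ℝ) / (((k:ℝ) + 1) ^ 2 * ((j:ℝ) + (k:ℝ) + 1) * 2 ^ (j + k + 1)))
     = ∫⁻ u in Ioo (0:ℝ) 1, ENNReal.ofReal (u^k * (-Real.log u)) * ENNReal.ofReal (1/(((j:ℝ)+k+1) * 2^(j+k+1))) := by
    intro k j
    rw [lintegral_mul_const' _ _ ENNReal.ofReal_ne_top, I1, ← ENNReal.ofReal_mul (by positivity)]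
    congr 1
    field_simp
  simp_rw [e]
  have e2 : ∀ k : ℕ, ∑' j : ℕ, ∫⁻ u in Ioo (0:ℝ) 1, ENNReal.ofReal (u^k * (-Real.log u)) * ENNReal.ofReal (1/(((j:ℝ)+k+1) * 2^(j+k+1)))
     = ∫⁻ u in Ioo (0:ℝ) 1, ∑' j : ℕ, ENNReal.ofReal (u^k * (-Real.log u)) * ENNReal.ofReal (1/(((j:ℝ)+k+1) * 2^(j+k+1))) := by
    intro k
    rw [lintegral_tsum (by intro i; fun_prop)]
  simp_rw [e2]
  rw [← lintegral_tsum (by intro i; fun_prop)]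
  have him : (fun t : ℝ => 1-t) '' Ioo 0 1 = Ioo 0 1 := by
    simp
  conv_lhs => rw [← him]
  rw [lintegral_image_eq_lintegral_abs_deriv_mul (f' := fun t => -1) measurableSet_Ioo]
  · refine setLIntegral_congr_fun measurableSet_Ioo ?_
    intro t ht
    have h0 := ht.1
    have h1 := ht.2
    have hl : 0 ≤ -Real.log (1-t) := by
      have := Real.log_nonpos (x := 1-t) (by linarith) (by linarith)
      linarith
    have hp := pw (1-t) ⟨by linarith, by linarith⟩
    have e3 : ∀ k j : ℕ, ENNReal.ofReal ((1-t)^k * (-Real.log (1-t))) * ENNReal.ofReal (1/(((j:ℝ)+k+1) * 2^(j+k+1)))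
       = ENNReal.ofReal (-Real.log (1-t)) * ENNReal.ofReal ((1-t)^k * (1/(((j:ℝ)+k+1) * 2^(j+k+1)))) := by
      intro k j
      have : 0 ≤ (1-t)^k := pow_nonneg (by linarith) k
      rw [← ENNReal.ofReal_mul (by positivity), ← ENNReal.ofReal_mul hl]
      congr 1; ring
    simp only [e3, ENNReal.tsum_mul_left, hp]
    rw [← ENNReal.ofReal_mul hl]
    simp only [abs_neg, abs_one, ENNReal.ofReal_one, one_mul]
    congr 1
    rw [show 2 - (1-t) = 1+t by ring, show 1-(1-t) = t by ring]
    ring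
  · intro x hx
    simpa using ((hasDerivAt_id x).const_sub 1).hasDerivWithinAt
  · intro x hx y hy h
    simpa using h

theorem K3 : 8 * (∫⁻ t in Ioo (0:ℝ) 1, ENNReal.ofReal (-(Real.log (1-t) * Real.log (1+t))/t))
   + ∫⁻ t in Ioo (0:ℝ) 1, ENNReal.ofReal (2 * ((Real.log (1-t^2))^2/t))
   = 2 * ∫⁻ t in Ioo (0:ℝ) 1, ENNReal.ofReal ((Real.log ((1-t)/(1+t)))^2/t) := by
  rw [← lintegral_const_mul' _ _ (by simp), ← lintegral_const_mul' _ _ (by simp),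
    ← lintegral_add_right _ (by fun_prop)]
  refine setLIntegral_congr_fun measurableSet_Ioo ?_
  intro t ht
  have h0 := ht.1
  have h1 := ht.2
  have hl : Real.log (1-t) ≤ 0 := Real.log_nonpos (x := 1-t) (by linarith) (by linarith)
  have hl2 : 0 ≤ Real.log (1+t) := Real.log_nonneg (by linarith)
  have h2 : (2:ENNReal) = ENNReal.ofReal 2 := by simp
  have h8 : (8:ENNReal) = ENNReal.ofReal 8 := by simp
  have hn : 0 ≤ -(Real.log (1-t) * Real.log (1+t)) := by nlinarith
  simp only
  rw [h2, h8, ← ENNReal.ofReal_mul (by norm_num), ← ENNReal.ofReal_mul (by norm_num), ← ENNReal.ofReal_add (by positivity) (by positivity)]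
  congr 1
  rw [show 1 - t^2 = (1-t)*(1+t) by ring, Real.log_mul (by linarith) (by linarith), Real.log_div (by linarith) (by linarith)]
  field_simp
  ring

theorem double_sum_eq :
    (∑' k : ℕ, ∑' j : ℕ,
      (1:ℝ) / (((k:ℝ) + 1) ^ 2 * ((j:ℝ) + (k:ℝ) + 1) * 2 ^ (j + k + 1)))
    = (5/8) * ∑' n : ℕ, 1 / ((n:ℝ) + 1) ^ 3 := by
  have hz : Summable (fun n : ℕ => 1 / ((n:ℝ) + 1) ^ 3) := by
    have := (summable_nat_add_iff 1).2 (Real.summable_one_div_nat_pow.2 (by norm_num : 1 < 3))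
    simpa using this
  have hK := K3
  rw [K1, K2, J1, J2, ← S_eq] at hK
  set z := ∑' n : ℕ, 1 / ((n:ℝ) + 1) ^ 3 with hzdef
  have hA : HasSum (fun n : ℕ => 2 / ((n:ℝ) + 1) ^ 3) (2 * z) := by
    have := hz.hasSum.mul_left 2
    exact this.congr_fun_val (fun n => by ring) rfl
  have hB : HasSum (fun n : ℕ => 2/((2*n:ℕ)+1:ℝ)^3) (7/4*z) := by
    have hodd : HasSum (fun n : ℕ => 2/((2*n+1:ℕ)+1:ℝ)^3) (z/4) := by
      refine (hz.hasSum.div_const 4).congr_fun_val (fun n => ?_) rfl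
      push_cast
      have : (n:ℝ)+1 ≠ 0 := by positivity
      rw [show 2*(n:ℝ)+1+1 = 2*(n+1) by ring]
      field_simp
      norm_num
    have hev : Summable (fun n : ℕ => 2/((2*n:ℕ)+1:ℝ)^3) :=
      hA.summable.comp_injective (i := fun n : ℕ => 2*n) (fun a b h => by simpa using h)
    have := tsum_even_add_odd (f := fun n : ℕ => 2 / ((n:ℝ) + 1) ^ 3) hev hodd.summable
    rw [hA.tsum_eq, hodd.tsum_eq] at this
    have h3 := hev.hasSum
    rwa [show ∑' n : ℕ, 2/((2*n:ℕ)+1:ℝ)^3 = 7/4*z by linarith] at h3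
  rw [← ENNReal.ofReal_tsum_of_nonneg (by intro n; positivity) hA.summable, hA.tsum_eq,
    ← ENNReal.ofReal_tsum_of_nonneg (by intro n; positivity) hB.summable, hB.tsum_eq] at hK
  have hz0 : 0 ≤ z := tsum_nonneg (by intro n; positivity)
  set S := ∑' k : ℕ, ∑' j : ℕ,
      ENNReal.ofReal ((1:ℝ) / (((k:ℝ) + 1) ^ 2 * ((j:ℝ) + (k:ℝ) + 1) * 2 ^ (j + k + 1))) with hS
  have hfin : S ≠ ⊤ := by
    intro h
    rw [h] at hK
    have : (2 * (2 * ENNReal.ofReal (7/4*z)) : ENNReal) ≠ ⊤ := by finiteness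
    rw [← hK] at this
    simp at this
  have hKr := congrArg ENNReal.toReal hK
  rw [ENNReal.toReal_add (by finiteness) (by finiteness)] at hKr
  simp only [ENNReal.toReal_mul] at hKr
  rw [ENNReal.toReal_ofReal (by positivity), ENNReal.toReal_ofReal (by positivity)] at hKr
  norm_num at hKr
  have hSr : S.toReal = ∑' k : ℕ, ∑' j : ℕ,
      (1:ℝ) / (((k:ℝ) + 1) ^ 2 * ((j:ℝ) + (k:ℝ) + 1) * 2 ^ (j + k + 1)) := by
    have hk := ENNReal.ne_top_of_tsum_ne_top hfin
    rw [hS, ENNReal.tsum_toReal_eq hk]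
    congr 1
    ext k
    rw [ENNReal.tsum_toReal_eq (fun _ => ENNReal.ofReal_ne_top)]
    congr 1
    ext j
    rw [ENNReal.toReal_ofReal (by positivity)]
  rw [← hSr]
  linarith
end

section
/- 2·Li₃(1/3) − Li₃(−1/3) = (13/6)·ζ(3) − (π²/6)·log 3 + (1/6)·(log 3)³. -/
noncomputable def Li (s : ℕ) (w : ℝ) : ℝ := ∑' n : ℕ, w ^ (n + 1) / ((n:ℝ) + 1) ^ s

open Set Filter Topology

lemma Li_zero (s : ℕ) : Li s 0 = 0 := by simp [Li]

lemma Li_one (x : ℝ) (h : |x| < 1) : Li 1 x = -Real.log (1 - x) := by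
  have := (Real.hasSum_pow_div_log_of_abs_lt_one h).tsum_eq
  simpa [Li] using this

lemma Li_hasDerivAt (s : ℕ) (x : ℝ) (h : |x| < 1) (h0 : x ≠ 0) :
    HasDerivAt (Li (s+1)) (Li s x / x) x := by
  obtain ⟨r, hr, hr1⟩ := exists_between h
  have hr0 : 0 ≤ r := (abs_nonneg x).trans hr.le
  have key := hasDerivAt_tsum_of_isPreconnected (𝕜 := ℝ)
    (g := fun (n : ℕ) (w : ℝ) => w ^ (n + 1) / ((n:ℝ) + 1) ^ (s+1))
    (g' := fun (n : ℕ) (w : ℝ) => w ^ n / ((n:ℝ) + 1) ^ s)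
    (u := fun n => r ^ n) (t := Metric.ball 0 r) (y₀ := 0) (y := x)
    (summable_geometric_of_lt_one hr0 hr1) Metric.isOpen_ball
    (convex_ball (0:ℝ) r).isPreconnected ?_ ?_ ?_ ?_ ?_
  · have e : Li s x / x = ∑' n : ℕ, x ^ n / ((n:ℝ) + 1) ^ s := by
      rw [Li, ← tsum_div_const]
      congr 1; ext n
      field_simp
      ring
    rw [e]
    exact key
  · intro n y _
    have := ((hasDerivAt_id y).pow (n+1)).div_const (((n:ℝ) + 1) ^ (s+1))
    refine this.congr_deriv ?_
    have : (n:ℝ) + 1 ≠ 0 := by positivity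
    simp
    field_simp
    ring
  · intro n y hy
    have hy' : |y| < r := by simpa using hy
    have h1 : (1:ℝ) ≤ ((n:ℝ) + 1) ^ s := one_le_pow₀ (by linarith [n.cast_nonneg (α := ℝ)])
    rw [Real.norm_eq_abs, abs_div, abs_pow, abs_of_pos (by positivity : (0:ℝ) < ((n:ℝ) + 1) ^ s)]
    calc |y| ^ n / ((n:ℝ) + 1) ^ s ≤ |y| ^ n := div_le_self (by positivity) h1
      _ ≤ r ^ n := by gcongr
  · simpa using (abs_nonneg x).trans_lt hr
  · simp
  · simpa using hr

lemma Li_continuousOn (s : ℕ) (hs : 2 ≤ s) : ContinuousOn (Li s) (Icc (-1) 1) := by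
  refine continuousOn_tsum (u := fun n : ℕ => 1 / ((n:ℝ) + 1) ^ s) (fun n => by fun_prop) ?_ ?_
  · have := (summable_nat_add_iff 1).2 (Real.summable_one_div_nat_pow.2 (show 1 < s by omega))
    simpa using this
  · intro n x hx
    have : |x| ≤ 1 := abs_le.2 hx
    rw [Real.norm_eq_abs, abs_div, abs_pow, abs_of_pos (by positivity : (0:ℝ) < ((n:ℝ) + 1) ^ s)]
    gcongr
    exact pow_le_one₀ (abs_nonneg _) this

lemma Li_comp_cont (s : ℕ) (hs : 2 ≤ s) (f : ℝ → ℝ) (t : Set ℝ) (hf : ContinuousOn f t)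
    (h : ∀ x ∈ t, -1 ≤ f x ∧ f x ≤ 1) : ContinuousOn (fun x => Li s (f x)) t :=
  (Li_continuousOn s hs).comp hf h

lemma Li2_d (f : ℝ → ℝ) (f' x : ℝ) (hf : HasDerivAt f f' x) (h1 : -1 < f x) (h2 : f x < 1)
    (h0 : f x ≠ 0) : HasDerivAt (fun x => Li 2 (f x)) (-Real.log (1 - f x) / f x * f') x := by
  have := (Li_hasDerivAt 1 (f x) (abs_lt.2 ⟨h1, h2⟩) h0).comp x hf
  rwa [Li_one _ (abs_lt.2 ⟨h1, h2⟩)] at this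

lemma Li3_d (f : ℝ → ℝ) (f' x : ℝ) (hf : HasDerivAt f f' x) (h1 : -1 < f x) (h2 : f x < 1)
    (h0 : f x ≠ 0) : HasDerivAt (fun x => Li 3 (f x)) (Li 2 (f x) / f x * f') x :=
  (Li_hasDerivAt 2 (f x) (abs_lt.2 ⟨h1, h2⟩) h0).comp x hf

lemma const_of (f f' : ℝ → ℝ) (b : ℝ) (hb : 0 ≤ b) (hc : ContinuousOn f (Icc 0 b))
    (hd : ∀ x ∈ Ioo 0 b, HasDerivAt f (f' x) x) (h0 : ∀ x ∈ Ioo 0 b, f' x = 0) : f b = f 0 := by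
  rcases hb.eq_or_lt with rfl | hb
  · rfl
  obtain ⟨c, hc, h⟩ := exists_hasDerivAt_eq_slope f f' hb hc hd
  rw [h0 c hc, eq_comm, div_eq_zero_iff] at h
  rcases h with h | h <;> linarith

lemma Li2_at_one : Li 2 1 = Real.pi ^ 2 / 6 := by
  have := (hasSum_nat_add_iff' 1).2 hasSum_zeta_two
  simpa [Li] using this.tsum_eq

lemma Li2_sq (x : ℝ) (h0 : 0 ≤ x) (h1 : x ≤ 1) : Li 2 (x^2) = 2 * (Li 2 x + Li 2 (-x)) := by
  have := const_of (fun x => Li 2 (x^2) - 2 * (Li 2 x + Li 2 (-x))) _ x h0 ?_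
    (fun y hy => (Li2_d (fun x => x^2) (2*y) y (by simpa using hasDerivAt_pow 2 y)
        (by nlinarith [hy.1]) (by nlinarith [hy.1, hy.2]) (by have := hy.1; positivity)).sub
      (((Li2_d (fun x => x) 1 y (hasDerivAt_id y) (by linarith [hy.1]) (by linarith [hy.2])
        hy.1.ne').add
        (Li2_d (fun x => -x) (-1) y (hasDerivAt_neg y) (by linarith [hy.2]) (by linarith [hy.1])
        (neg_ne_zero.2 hy.1.ne'))).const_mul 2)) ?_
  · simp [Li_zero] at this; linarith
  · have a1 := Li_comp_cont 2 le_rfl (fun x => x^2) (Icc 0 x) (by fun_prop)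
      (fun y hy => ⟨by nlinarith [hy.1], by nlinarith [hy.1, hy.2]⟩)
    have a2 := Li_comp_cont 2 le_rfl (fun x => x) (Icc 0 x) (by fun_prop)
      (fun y hy => ⟨by linarith [hy.1], by linarith [hy.1, hy.2]⟩)
    have a3 := Li_comp_cont 2 le_rfl (fun x => -x) (Icc 0 x) (by fun_prop)
      (fun y hy => ⟨by linarith [hy.2], by linarith [hy.1, hy.2]⟩)
    fun_prop
  · intro y ⟨hy, hy1⟩
    have e : Real.log (1 - y^2) = Real.log (1 - y) + Real.log (1 + y) := by
      rw [← Real.log_mul (by linarith) (by linarith)]; ring_nf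
    simp only [e, sub_neg_eq_add]
    field_simp
    ring

lemma Li3_sq (x : ℝ) (h0 : 0 ≤ x) (h1 : x ≤ 1) : Li 3 (x^2) = 4 * (Li 3 x + Li 3 (-x)) := by
  have := const_of (fun x => Li 3 (x^2) - 4 * (Li 3 x + Li 3 (-x))) _ x h0 ?_
    (fun y hy => (Li3_d (fun x => x^2) (2*y) y (by simpa using hasDerivAt_pow 2 y)
        (by nlinarith [hy.1]) (by nlinarith [hy.1, hy.2]) (by have := hy.1; positivity)).sub
      (((Li3_d (fun x => x) 1 y (hasDerivAt_id y) (by linarith [hy.1]) (by linarith [hy.2])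
        hy.1.ne').add
        (Li3_d (fun x => -x) (-1) y (hasDerivAt_neg y) (by linarith [hy.2]) (by linarith [hy.1])
        (neg_ne_zero.2 hy.1.ne'))).const_mul 4)) ?_
  · simp [Li_zero] at this; linarith
  · have a1 := Li_comp_cont 3 (by norm_num) (fun x => x^2) (Icc 0 x) (by fun_prop)
      (fun y hy => ⟨by nlinarith [hy.1], by nlinarith [hy.1, hy.2]⟩)
    have a2 := Li_comp_cont 3 (by norm_num) (fun x => x) (Icc 0 x) (by fun_prop)
      (fun y hy => ⟨by linarith [hy.1], by linarith [hy.1, hy.2]⟩)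
    have a3 := Li_comp_cont 3 (by norm_num) (fun x => -x) (Icc 0 x) (by fun_prop)
      (fun y hy => ⟨by linarith [hy.2], by linarith [hy.1, hy.2]⟩)
    fun_prop
  · intro y ⟨hy, hy1⟩
    simp only [Li2_sq y hy.le (by linarith)]
    field_simp
    ring

lemma Li2_neg_one : Li 2 (-1) = -(Real.pi ^ 2 / 12) := by
  have := Li2_sq 1 (by norm_num) le_rfl
  norm_num [Li2_at_one] at this; linarith

lemma Li3_neg_one : Li 3 (-1) = -(3/4) * Li 3 1 := by
  have := Li3_sq 1 (by norm_num) le_rfl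
  norm_num at this; linarith

lemma d_log (f : ℝ → ℝ) (f' x : ℝ) (hf : HasDerivAt f f' x) (h0 : f x ≠ 0) :
    HasDerivAt (fun x => Real.log (f x)) (f' / f x) x := hf.log h0

/-- continuity of `log x * log (1 + c x)` including at zero -/
lemma cont_loglog (c : ℝ) (hc : |c| = 1) (b : ℝ) (hb : b ≤ 1/2) :
    ContinuousOn (fun x => Real.log x * Real.log (1 + c * x)) (Icc 0 b) := by
  have hcc := abs_le.1 hc.le
  intro x hx
  rcases hx.1.eq_or_lt with rfl | hx0
  · have h1 : Tendsto (fun x : ℝ => |2 * (x * Real.log x)|) (𝓝[Icc 0 b] 0) (𝓝 0) := by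
      have : Continuous (fun x : ℝ => |2 * (x * Real.log x)|) :=
        (continuous_const.mul Real.continuous_mul_log).abs
      have := (this.tendsto 0).mono_left (nhdsWithin_le_nhds (s := Icc 0 b))
      simpa using this
    rw [ContinuousWithinAt]
    simp only [Real.log_zero, zero_mul]
    refine squeeze_zero_norm' ?_ h1
    filter_upwards [self_mem_nhdsWithin] with y hy
    have hy0 := hy.1
    have hy1 := hy.2
    have hcy : |c * y| = y := by rw [abs_mul, hc, abs_of_nonneg hy0, one_mul]
    have hcy' := abs_le.1 hcy.le
    have hlog : |Real.log (1 + c * y)| ≤ 2 * y := by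
      have hp : 0 < 1 + c * y := by linarith
      have u := Real.log_le_sub_one_of_pos hp
      have l := Real.one_sub_inv_le_log_of_pos hp
      have : (1 + c*y)⁻¹ ≤ 1 + 2 * y := by
        rw [inv_le_iff_one_le_mul₀ hp]; nlinarith
      rw [abs_le]; constructor <;> linarith
    rw [Real.norm_eq_abs, abs_mul, abs_mul, abs_mul, abs_of_nonneg hy0, abs_two]
    nlinarith [abs_nonneg (Real.log y)]
  · apply ContinuousAt.continuousWithinAt
    have : 1 + c * x ≠ 0 := by nlinarith [hx.2]
    have := hx0.ne'
    fun_prop (disch := assumption)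

lemma Li2_refl (x : ℝ) (h0 : 0 < x) (h1 : x ≤ 1/2) :
    Li 2 (1 - x) = Real.pi^2/6 - Real.log x * Real.log (1 - x) - Li 2 x := by
  have := const_of (fun x => Li 2 x + Li 2 (1 - x) + Real.log x * Real.log (1 - x)) _ x h0.le ?_
    (fun y hy => ((Li2_d (fun x => x) 1 y (hasDerivAt_id y) (by linarith [hy.1])
        (by linarith [hy.2]) hy.1.ne').add
      (Li2_d (fun x => 1 - x) (-1) y ((hasDerivAt_id y).const_sub 1) (by linarith [hy.2])
        (by linarith [hy.1]) (by linarith [hy.2]))).add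
      ((d_log (fun x => x) 1 y (hasDerivAt_id y) hy.1.ne').mul
      (d_log (fun x => 1 - x) (-1) y ((hasDerivAt_id y).const_sub 1) (by linarith [hy.2])))) ?_
  · simp [Li_zero, Li2_at_one] at this; linarith
  · have a1 := Li_comp_cont 2 le_rfl (fun x => x) (Icc 0 x) (by fun_prop)
      (fun y hy => ⟨by linarith [hy.1], by linarith [hy.1, hy.2]⟩)
    have a2 := Li_comp_cont 2 le_rfl (fun x => 1 - x) (Icc 0 x) (by fun_prop)
      (fun y hy => ⟨by linarith [hy.2], by linarith [hy.1, hy.2]⟩)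
    have a3 : ContinuousOn (fun x => Real.log x * Real.log (1 - x)) (Icc 0 x) := by
      simpa [sub_eq_add_neg] using cont_loglog (-1) (by simp) x h1
    exact (a1.add a2).add a3
  · intro y ⟨hy, hy1⟩
    have : 1 - y ≠ 0 := by linarith
    simp only [sub_sub_cancel]
    field_simp
    ring

lemma d_lan (y : ℝ) (h : y < 1) :
    HasDerivAt (fun x : ℝ => -x / (1 - x)) (-1 / (1 - y)^2) y := by
  have h1 : 1 - y ≠ 0 := by linarith
  refine ((hasDerivAt_neg y).div ((hasDerivAt_id y).const_sub 1) h1).congr_deriv ?_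
  simp only [id]
  congr 1; ring

lemma lan_mem (y : ℝ) (h0 : 0 ≤ y) (h : y ≤ 1/2) : -1 ≤ -y / (1 - y) ∧ -y / (1-y) ≤ 1 := by
  have h1 : 0 < 1 - y := by linarith
  rw [le_div_iff₀ h1, div_le_iff₀ h1]; constructor <;> linarith

lemma lan_mem' (y : ℝ) (h0 : 0 < y) (h : y < 1/2) :
    -1 < -y / (1 - y) ∧ -y / (1-y) < 1 ∧ -y / (1-y) ≠ 0 := by
  have h1 : 0 < 1 - y := by linarith
  rw [lt_div_iff₀ h1, div_lt_iff₀ h1]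
  refine ⟨by linarith, by linarith, ?_⟩
  exact div_ne_zero (by linarith) h1.ne'

lemma Li2_landen (x : ℝ) (h0 : 0 ≤ x) (h1 : x ≤ 1/2) :
    Li 2 (-x / (1 - x)) = -(1/2) * Real.log (1 - x)^2 - Li 2 x := by
  have := const_of (fun x => Li 2 x + Li 2 (-x / (1 - x)) + (1/2) * Real.log (1 - x)^2) _ x h0 ?_
    (fun y hy => ((Li2_d (fun x => x) 1 y (hasDerivAt_id y) (by linarith [hy.1])
        (by linarith [hy.2]) hy.1.ne').add
      (Li2_d (fun x => -x / (1 - x)) _ y (d_lan y (by linarith [hy.2]))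
        (lan_mem' y hy.1 (by linarith [hy.2])).1 (lan_mem' y hy.1 (by linarith [hy.2])).2.1
        (lan_mem' y hy.1 (by linarith [hy.2])).2.2)).add
      (((d_log (fun x => 1 - x) (-1) y ((hasDerivAt_id y).const_sub 1)
        (by linarith [hy.2])).pow 2).const_mul (1/2))) ?_
  · simp [Li_zero] at this; linarith
  · have a1 := Li_comp_cont 2 le_rfl (fun x => x) (Icc 0 x) (by fun_prop)
      (fun y hy => ⟨by linarith [hy.1], by linarith [hy.1, hy.2]⟩)
    have n : ∀ y ∈ Icc 0 x, 1 - y ≠ 0 := fun y hy => by linarith [hy.2]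
    have a2 := Li_comp_cont 2 le_rfl (fun x => -x / (1 - x)) (Icc 0 x)
      (by fun_prop (disch := assumption))
      (fun y hy => lan_mem y hy.1 (by linarith [hy.2]))
    have a3 : ContinuousOn (fun x => Real.log (1 - x)) (Icc 0 x) := by
      fun_prop (disch := assumption)
    fun_prop
  · intro y ⟨hy, hy1⟩
    have : 1 - y ≠ 0 := by linarith
    have e : Real.log (1 - -y / (1 - y)) = -Real.log (1 - y) := by
      rw [← Real.log_inv]; congr 1; field_simp; ring
    simp only [e]
    field_simp
    ring

lemma Li3_landen (x : ℝ) (h0 : 0 ≤ x) (h1 : x ≤ 1/2) :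
    Li 3 x + Li 3 (1 - x) + Li 3 (-x / (1 - x)) = Li 3 1 + Real.pi^2/6 * Real.log (1 - x)
      - (1/2) * (Real.log x * Real.log (1 - x)) * Real.log (1 - x)
      + (1/6) * Real.log (1-x)^3 := by
  have := const_of (fun x => Li 3 x + Li 3 (1 - x) + Li 3 (-x / (1 - x))
      - Real.pi^2/6 * Real.log (1 - x)
      + (1/2) * ((Real.log x * Real.log (1 - x)) * Real.log (1 - x))
      - (1/6) * Real.log (1-x)^3) _ x h0 ?_
    (fun y hy => 
      have dl := d_log (fun x => 1 - x) (-1) y ((hasDerivAt_id y).const_sub 1)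
        (by linarith [hy.2])
      (((((Li3_d (fun x => x) 1 y (hasDerivAt_id y) (by linarith [hy.1])
        (by linarith [hy.2]) hy.1.ne').add
      (Li3_d (fun x => 1 - x) (-1) y ((hasDerivAt_id y).const_sub 1) (by linarith [hy.2])
        (by linarith [hy.1]) (by linarith [hy.2]))).add
      (Li3_d (fun x => -x / (1 - x)) _ y (d_lan y (by linarith [hy.2]))
        (lan_mem' y hy.1 (by linarith [hy.2])).1 (lan_mem' y hy.1 (by linarith [hy.2])).2.1
        (lan_mem' y hy.1 (by linarith [hy.2])).2.2)).sub (dl.const_mul (Real.pi^2/6))).add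
      ((((d_log (fun x => x) 1 y (hasDerivAt_id y) hy.1.ne').mul dl).mul dl).const_mul (1/2))).sub
      ((dl.pow 3).const_mul (1/6))) ?_
  · simp [Li_zero] at this; linarith
  · have a1 := Li_comp_cont 3 (by norm_num) (fun x => x) (Icc 0 x) (by fun_prop)
      (fun y hy => ⟨by linarith [hy.1], by linarith [hy.1, hy.2]⟩)
    have n : ∀ y ∈ Icc 0 x, 1 - y ≠ 0 := fun y hy => by linarith [hy.2]
    have a2 := Li_comp_cont 3 (by norm_num) (fun x => -x / (1 - x)) (Icc 0 x)
      (by fun_prop (disch := assumption))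
      (fun y hy => lan_mem y hy.1 (by linarith [hy.2]))
    have a3 : ContinuousOn (fun x => Real.log (1 - x)) (Icc 0 x) := by
      fun_prop (disch := assumption)
    have a4 := Li_comp_cont 3 (by norm_num) (fun x => 1 - x) (Icc 0 x) (by fun_prop)
      (fun y hy => ⟨by linarith [hy.2], by linarith [hy.1, hy.2]⟩)
    have a5 : ContinuousOn (fun x => Real.log x * Real.log (1 - x)) (Icc 0 x) := by
      simpa [sub_eq_add_neg] using cont_loglog (-1) (by simp) x h1
    exact ((((a1.add a4).add a2).sub (continuousOn_const.mul a3)).add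
      (continuousOn_const.mul (a5.mul a3))).sub (continuousOn_const.mul (a3.pow 3))
  · intro y ⟨hy, hy1⟩
    have : 1 - y ≠ 0 := by linarith
    simp only [Pi.mul_apply, Li2_landen y hy.le (by linarith), Li2_refl y hy (by linarith)]
    field_simp
    ring

lemma d_t (y : ℝ) (h : 0 < y) :
    HasDerivAt (fun x : ℝ => (1 - x) / (1 + x)) (-2 / (1 + y)^2) y := by
  have h1 : 1 + y ≠ 0 := by linarith
  refine (((hasDerivAt_id y).const_sub 1).div ((hasDerivAt_id y).const_add 1) h1).congr_deriv ?_
  simp only [id]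
  congr 1; ring

lemma t_mem (y : ℝ) (h0 : 0 ≤ y) (h : y ≤ 1/2) : 0 < (1 - y) / (1 + y) ∧ (1-y) / (1+y) ≤ 1 := by
  have h1 : 0 < 1 + y := by linarith
  rw [div_le_iff₀ h1]; exact ⟨div_pos (by linarith) h1, by linarith⟩

lemma t_mem' (y : ℝ) (h0 : 0 < y) : (1-y) / (1+y) < 1 := by
  have h1 : 0 < 1 + y := by linarith
  rw [div_lt_iff₀ h1]; linarith

lemma Li2_t (x : ℝ) (h0 : 0 ≤ x) (h1 : x ≤ 1/2) :
    Li 2 ((1 - x) / (1 + x)) - Li 2 (-((1 - x) / (1 + x))) = Real.pi^2/4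
      + Real.log x * (Real.log (1 + x) - Real.log (1 - x)) - (Li 2 x - Li 2 (-x)) := by
  have := const_of (fun x => Li 2 ((1 - x) / (1 + x)) - Li 2 (-((1 - x) / (1 + x)))
      + (Li 2 x - Li 2 (-x))
      - (Real.log x * Real.log (1 + x) - Real.log x * Real.log (1 - x))) _ x h0 ?_
    (fun y hy => 
      have dm := d_log (fun x => 1 - x) (-1) y ((hasDerivAt_id y).const_sub 1)
        (by linarith [hy.2])
      have dp := d_log (fun x => 1 + x) 1 y ((hasDerivAt_id y).const_add 1)
        (by linarith [hy.1])
      have da := d_log (fun x => x) 1 y (hasDerivAt_id y) hy.1.ne'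
      have tm := t_mem y hy.1.le (by linarith [hy.2])
      have tm' := t_mem' y hy.1
      have dt := d_t y hy.1
      (((Li2_d _ _ y dt (by linarith) tm' tm.1.ne').sub
        (Li2_d _ _ y dt.neg (neg_lt_neg tm') ((neg_lt_zero.2 tm.1).trans one_pos)
          (neg_ne_zero.2 tm.1.ne'))).add
       ((Li2_d (fun x => x) 1 y (hasDerivAt_id y) (by linarith [hy.1])
        (by linarith [hy.2]) hy.1.ne').sub
        (Li2_d (fun x => -x) (-1) y (hasDerivAt_neg y) (by linarith [hy.2]) (by linarith [hy.1])
        (neg_ne_zero.2 hy.1.ne')))).sub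
      ((da.mul dp).sub (da.mul dm))) ?_
  · simp [Li_zero, Li2_at_one, Li2_neg_one] at this; linarith
  · have n : ∀ y ∈ Icc 0 x, 1 + y ≠ 0 := fun y hy => by linarith [hy.1]
    have c : ContinuousOn (fun x : ℝ => (1 - x) / (1 + x)) (Icc 0 x) := by
      fun_prop (disch := assumption)
    have a1 := Li_comp_cont 2 le_rfl (fun x => x) (Icc 0 x) (by fun_prop)
      (fun y hy => ⟨by linarith [hy.1], by linarith [hy.1, hy.2]⟩)
    have a2 := Li_comp_cont 2 le_rfl (fun x => -x) (Icc 0 x) (by fun_prop)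
      (fun y hy => ⟨by linarith [hy.2], by linarith [hy.1, hy.2]⟩)
    have a3 := Li_comp_cont 2 le_rfl _ (Icc 0 x) c
      (fun y hy => by have := t_mem y hy.1 (by linarith [hy.2]); constructor <;> linarith)
    have a4 := Li_comp_cont 2 le_rfl _ (Icc 0 x) c.neg
      (fun y hy => by
        have := t_mem y hy.1 (by linarith [hy.2])
        simp only [Pi.neg_apply]
        constructor <;> linarith)
    have a5 : ContinuousOn (fun x => Real.log x * Real.log (1 - x)) (Icc 0 x) := by
      simpa [sub_eq_add_neg] using cont_loglog (-1) (by simp) x h1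
    have a6 : ContinuousOn (fun x => Real.log x * Real.log (1 + x)) (Icc 0 x) := by
      simpa using cont_loglog 1 (by simp) x h1
    exact ((a3.sub a4).add (a1.sub a2)).sub (a6.sub a5)
  · intro y ⟨hy, hy1⟩
    have m : 1 - y ≠ 0 := by linarith
    have p : 1 + y ≠ 0 := by linarith
    have e1 : Real.log (1 - (1 - y) / (1 + y)) = Real.log 2 + Real.log y - Real.log (1 + y) := by
      rw [← Real.log_mul (by norm_num) hy.ne', ← Real.log_div (by positivity) p]
      congr 1; field_simp; ring
    have e2 : Real.log (1 + (1 - y) / (1 + y)) = Real.log 2 - Real.log (1 + y) := by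
      rw [← Real.log_div (by positivity) p]
      congr 1; field_simp; ring
    simp only [Pi.neg_apply, sub_neg_eq_add, e1, e2]
    field_simp
    ring

lemma d_i (y : ℝ) (h : 0 < y) :
    HasDerivAt (fun x : ℝ => 1 / (1 + x)) (-1 / (1 + y)^2) y := by
  have h1 : 1 + y ≠ 0 := by linarith
  refine ((hasDerivAt_const y (1:ℝ)).div ((hasDerivAt_id y).const_add 1) h1).congr_deriv ?_
  simp only [id]
  congr 1; ring

lemma i_mem (y : ℝ) (h0 : 0 ≤ y) : 0 < 1 / (1 + y) ∧ 1 / (1+y) ≤ 1 := by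
  have h1 : 0 < 1 + y := by linarith
  rw [div_le_iff₀ h1]; exact ⟨div_pos (by linarith) h1, by linarith⟩

lemma i_mem' (y : ℝ) (h0 : 0 < y) : 1 / (1+y) < 1 := by
  have h1 : 0 < 1 + y := by linarith
  rw [div_lt_iff₀ h1]; linarith

lemma Li2_i (y : ℝ) (h0 : 0 < y) (h1 : y ≤ 1/2) : Li 2 (1 / (1 + y)) = Real.pi^2/6
    + Real.log y * Real.log (1 + y) - (1/2) * Real.log (1+y)^2 + Li 2 (-y) := by
  have p : 0 < 1 + y := by linarith
  have hz : y / (1+y) ≤ 1/2 := by rw [div_le_iff₀ p]; linarith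
  have hz0 : 0 < y / (1+y) := by positivity
  have r := Li2_refl _ hz0 hz
  have l := Li2_landen _ hz0.le hz
  have e : 1 - y / (1+y) = 1 / (1+y) := by field_simp; ring
  have e2 : -(y / (1+y)) / (1 / (1+y)) = -y := by field_simp
  rw [e, Real.log_div h0.ne' p.ne', Real.log_div one_ne_zero p.ne', Real.log_one] at r
  rw [e, e2, Real.log_div one_ne_zero p.ne', Real.log_one] at l
  rw [r]
  linear_combination -l

lemma Li3_t (x : ℝ) (h0 : 0 ≤ x) (h1 : x ≤ 1/2) :
    Li 3 ((1 - x) / (1 + x)) - Li 3 (-((1 - x) / (1 + x))) - 2 * Li 3 (1 - x)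
      - 2 * Li 3 (1 / (1 + x)) + (1/2) * Li 3 (1 - x^2) =
    -(7/4) * Li 3 1 + Real.pi^2/6 * Real.log (1 + x) - (1/3) * Real.log (1+x)^3 := by
  have := const_of (fun x => Li 3 ((1 - x) / (1 + x)) - Li 3 (-((1 - x) / (1 + x)))
      - 2 * Li 3 (1 - x) - 2 * Li 3 (1 / (1 + x)) + (1/2) * Li 3 (1 - x^2)
      - Real.pi^2/6 * Real.log (1 + x) + (1/3) * Real.log (1+x)^3) _ x h0 ?_
    (fun y hy => 
      have dp := d_log (fun x => 1 + x) 1 y ((hasDerivAt_id y).const_add 1)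
        (by linarith [hy.1])
      have tm := t_mem y hy.1.le (by linarith [hy.2])
      have tm' := t_mem' y hy.1
      have dt := d_t y hy.1
      have im := i_mem y hy.1.le
      ((((((Li3_d _ _ y dt (by linarith) tm' tm.1.ne').sub
        (Li3_d _ _ y dt.neg (neg_lt_neg tm') ((neg_lt_zero.2 tm.1).trans one_pos)
          (neg_ne_zero.2 tm.1.ne'))).sub
       ((Li3_d (fun x => 1 - x) (-1) y ((hasDerivAt_id y).const_sub 1) (by linarith [hy.2])
        (by linarith [hy.1]) (by linarith [hy.2])).const_mul 2)).sub
       ((Li3_d _ _ y (d_i y hy.1) (by linarith) (i_mem' y hy.1) im.1.ne').const_mul 2)).add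
       ((Li3_d (fun x => 1 - x^2) (-(2*y)) y
          ((by simpa using hasDerivAt_pow 2 y : HasDerivAt (fun x : ℝ => x^2) (2*y) y).const_sub 1)
          (by nlinarith [hy.1, hy.2]) (by nlinarith [hy.1])
          (by nlinarith [hy.1, hy.2])).const_mul (1/2))).sub
       (dp.const_mul (Real.pi^2/6))).add ((dp.pow 3).const_mul (1/3))) ?_
  · simp [Li3_neg_one] at this; rw [one_div (1 + x)]; linarith
  · have n : ∀ y ∈ Icc 0 x, 1 + y ≠ 0 := fun y hy => by linarith [hy.1]
    have c : ContinuousOn (fun x : ℝ => (1 - x) / (1 + x)) (Icc 0 x) := by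
      fun_prop (disch := assumption)
    have a1 := Li_comp_cont 3 (by norm_num) (fun x => 1 - x) (Icc 0 x) (by fun_prop)
      (fun y hy => ⟨by linarith [hy.2], by linarith [hy.1, hy.2]⟩)
    have a2 := Li_comp_cont 3 (by norm_num) (fun x => 1 - x^2) (Icc 0 x) (by fun_prop)
      (fun y hy => ⟨by nlinarith [hy.1, hy.2], by nlinarith [hy.1, hy.2]⟩)
    have a3 := Li_comp_cont 3 (by norm_num) _ (Icc 0 x) c
      (fun y hy => by have := t_mem y hy.1 (by linarith [hy.2]); constructor <;> linarith)
    have a4 := Li_comp_cont 3 (by norm_num) _ (Icc 0 x) c.neg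
      (fun y hy => by
        have := t_mem y hy.1 (by linarith [hy.2])
        simp only [Pi.neg_apply]
        constructor <;> linarith)
    have a5 := Li_comp_cont 3 (by norm_num) (fun x => 1 / (1 + x)) (Icc 0 x)
      (by fun_prop (disch := assumption))
      (fun y hy => by have := i_mem y hy.1; constructor <;> linarith)
    have a6 : ContinuousOn (fun x => Real.log (1 + x)) (Icc 0 x) := by
      fun_prop (disch := assumption)
    exact (((((a3.sub a4).sub (continuousOn_const.mul a1)).sub (continuousOn_const.mul a5)).add
      (continuousOn_const.mul a2)).sub (continuousOn_const.mul a6)).add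
      (continuousOn_const.mul (a6.pow 3))
  · intro y ⟨hy, hy1⟩
    have m : 1 - y ≠ 0 := by linarith
    have p : 1 + y ≠ 0 := by linarith
    have e : Real.log (1 - y^2) = Real.log (1 - y) + Real.log (1 + y) := by
      rw [← Real.log_mul (by linarith) (by linarith)]; ring_nf
    have q : 1 - y^2 = (1 - y) * (1 + y) := by ring
    have T := Li2_t y hy.le (by linarith)
    have S := Li2_refl (y^2) (by positivity) (by nlinarith)
    rw [e, Real.log_pow, Li2_sq y hy.le (by linarith)] at S
    rw [sub_eq_iff_eq_add] at T
    simp only [Pi.neg_apply, T, S, Li2_i y hy (by linarith), Li2_refl y hy (by linarith)]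
    rw [q]
    push_cast
    field_simp
    ring

theorem Li3_third :
    2 * Li 3 (1/3) - Li 3 (-(1/3))
    = (13/6) * (∑' n : ℕ, 1 / ((n:ℝ) + 1) ^ 3)
      - (Real.pi ^ 2 / 6) * Real.log 3 + (1/6) * (Real.log 3) ^ 3 := by
  have hz : (∑' n : ℕ, 1 / ((n:ℝ) + 1) ^ 3) = Li 3 1 := by simp [Li]
  rw [hz]
  have A := Li3_t (1/2) (by norm_num) le_rfl
  have B := Li3_landen (1/2) (by norm_num) le_rfl
  have C := Li3_landen (1/3) (by norm_num) (by norm_num)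
  have D := Li3_landen (1/4) (by norm_num) (by norm_num)
  have E := Li3_sq (1/2) (by norm_num) (by norm_num)
  have l1 : Real.log (3/2) = Real.log 3 - Real.log 2 := Real.log_div (by norm_num) (by norm_num)
  have l2 : Real.log (2/3) = Real.log 2 - Real.log 3 := Real.log_div (by norm_num) (by norm_num)
  have l4 : Real.log 4 = 2 * Real.log 2 := by
    rw [show (4:ℝ) = 2^2 by norm_num, Real.log_pow]; norm_num
  have l3 : Real.log (3/4) = Real.log 3 - 2 * Real.log 2 := by
    rw [Real.log_div (by norm_num) (by norm_num), l4]
  have l5 : Real.log (1/2) = -Real.log 2 := by simp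
  have l6 : Real.log (1/3) = -Real.log 3 := by simp
  have l7 : Real.log (1/4) = -(2 * Real.log 2) := by rw [← l4]; simp
  rw [show (1 - 1/2 : ℝ) / (1 + 1/2) = 1/3 by norm_num, show (1 - 1/2 : ℝ) = 1/2 by norm_num,
    show 1 / (1 + 1/2 : ℝ) = 2/3 by norm_num, show (1 - (1/2)^2 : ℝ) = 3/4 by norm_num,
    show (1 + 1/2 : ℝ) = 3/2 by norm_num, l1] at A
  rw [show (1 - 1/2 : ℝ) = 1/2 by norm_num, show -(1/2) / (1/2 : ℝ) = -1 by norm_num,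
    Li3_neg_one, l5] at B
  rw [show (1 - 1/3 : ℝ) = 2/3 by norm_num, show -(1/3) / (2/3 : ℝ) = -(1/2) by norm_num,
    l2, l6] at C
  rw [show (1 - 1/4 : ℝ) = 3/4 by norm_num, show -(1/4) / (3/4 : ℝ) = -(1/3) by norm_num,
    l3, l7] at D
  rw [show ((1/2)^2 : ℝ) = 1/4 by norm_num] at E
  linear_combination (2/3) * A + (4/3) * B + (4/3) * C - (1/3) * D + (1/3) * E
end
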